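/- (L∞ bound via the maximum principle) There exists a constant C > 0 depending only on V such that the following holds: for every bounded smooth domain Ω ⊂ ℝ², every ε with 0 < ε ≤ 1, every solution u_ε of the vectorial Allen–Cahn system on Ω, and every x ∈ Ω with dist(x,∂Ω) ≥ 2ε, one has |u_ε(x)|² ≤ C·E_ε(u_ε,Ω)/dist(x,∂Ω) + 2·max{|σ|² : σ ∈ Σ}. -/

import Mathlib

open MeasureTheory Metric Filter Topology Bornology
open scoped RealInnerProductSpace ENNReal Topology

noncomputable section

/-- The euclidean plane. -/
abbrev E2 : Type := EuclideanSpace ℝ (Fin 2)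

/-- The euclidean space `ℝ^k`. -/
abbrev Evec (k : ℕ) : Type := EuclideanSpace ℝ (Fin k)

/-- The `i`-th standard basis vector of the plane. -/
def b2 (i : Fin 2) : E2 := EuclideanSpace.single i (1 : ℝ)

/-- The partial derivative of `u` in the `i`-th coordinate direction. -/
def pder {k : ℕ} (u : E2 → Evec k) (i : Fin 2) (x : E2) : Evec k :=
  fderiv ℝ u x (b2 i)

/-- The Laplacian of a map defined on the plane. -/
def lap {k : ℕ} (u : E2 → Evec k) (x : E2) : Evec k :=
  ∑ i : Fin 2, fderiv ℝ (pder u i) x (b2 i)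

/-- `u` is a smooth solution of the vectorial Allen-Cahn system
`Δu = ε⁻² ∇V(u)` on the open set `U`. -/
def IsSolution {k : ℕ} (V : Evec k → ℝ) (ε : ℝ) (U : Set E2) (u : E2 → Evec k) : Prop :=
  ContDiffOn ℝ (⊤ : ℕ∞) u U ∧ ∀ x ∈ U, lap u x = (ε ^ 2)⁻¹ • gradient V (u x)

/-- The squared modulus `|∇u|²` of the full gradient. -/
def gradSq {k : ℕ} (u : E2 → Evec k) (x : E2) : ℝ :=
  ∑ i : Fin 2, ‖pder u i x‖ ^ 2

/-- The energy density `e_ε(u) = (ε/2)|∇u|² + ε⁻¹ V(u)`. -/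
def eDens {k : ℕ} (V : Evec k → ℝ) (ε : ℝ) (u : E2 → Evec k) (x : E2) : ℝ :=
  ε / 2 * gradSq u x + ε⁻¹ * V (u x)

/-- The energy `E_ε(u, G)`. -/
def energy {k : ℕ} (V : Evec k → ℝ) (ε : ℝ) (u : E2 → Evec k) (G : Set E2) : ℝ :=
  ∫ x in G, eDens V ε u x

/-- The hypotheses (H₁), (H₂), (H₃) on the multi-well potential `V`:
smooth, nonnegative with `inf V = 0`, finitely many zeros (at least two),
positive definite Hessian at each zero, quadratic growth of `y·∇V(y)` at
infinity and coercivity. -/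
structure IsMultiWell {k : ℕ} (V : Evec k → ℝ) : Prop where
  smooth : ContDiff ℝ (⊤ : ℕ∞) V
  nonneg : ∀ y, 0 ≤ V y
  finite_zeros : {y : Evec k | V y = 0}.Finite
  two_le_card : 2 ≤ {y : Evec k | V y = 0}.ncard
  hess_posdef : ∀ σ : Evec k, V σ = 0 → ∀ w : Evec k, w ≠ 0 →
    0 < iteratedFDeriv ℝ 2 V σ ![w, w]
  growth : ∃ α > (0 : ℝ), ∃ R > (0 : ℝ), ∀ y : Evec k, R < ‖y‖ →
    α * ‖y‖ ^ 2 ≤ ⟪y, gradient V y⟫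
  coercive : ∀ C : ℝ, ∃ R : ℝ, ∀ y : Evec k, R ≤ ‖y‖ → C ≤ V y

namespace AllenCahn

section PlaneCalculus

variable {F : Type*} [NormedAddCommGroup F] [NormedSpace ℝ F]

/-- The first coordinate direction of `ℝ × ℝ`. -/
abbrev e₁ : ℝ × ℝ := (1, 0)

/-- The second coordinate direction of `ℝ × ℝ`. -/
abbrev e₂ : ℝ × ℝ := (0, 1)

/-- The derivative of `f` in the direction `v`. -/
def dd (v : ℝ × ℝ) (f : ℝ × ℝ → F) (p : ℝ × ℝ) : F := fderiv ℝ f p v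

/-- The Laplacian on `ℝ × ℝ`. -/
def lapl (f : ℝ × ℝ → F) (p : ℝ × ℝ) : F := dd e₁ (dd e₁ f) p + dd e₂ (dd e₂ f) p

/-- The closed square of half-side `r` centred at the origin. -/
def Sq (r : ℝ) : Set (ℝ × ℝ) := closedBall 0 r

lemma mem_Sq {r : ℝ} {p : ℝ × ℝ} : p ∈ Sq r ↔ |p.1| ≤ r ∧ |p.2| ≤ r := by
  simp [Sq, Prod.norm_def]

lemma Sq_mono {r s : ℝ} (h : r ≤ s) : Sq r ⊆ Sq s := closedBall_subset_closedBall h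

lemma isCompact_Sq (r : ℝ) : IsCompact (Sq r) := isCompact_closedBall _ _

lemma measurableSet_Sq (r : ℝ) : MeasurableSet (Sq r) := measurableSet_closedBall

lemma contDiff_dd {f : ℝ × ℝ → F} (hf : ContDiff ℝ (⊤ : ℕ∞) f) (v : ℝ × ℝ) :
    ContDiff ℝ (⊤ : ℕ∞) (dd v f) :=
  (hf.fderiv_right (m := (⊤ : ℕ∞)) (by simp)).clm_apply contDiff_const

lemma continuous_dd {f : ℝ × ℝ → F} (hf : ContDiff ℝ 1 f) (v : ℝ × ℝ) :
    Continuous (dd v f) :=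
  (hf.continuous_fderiv (by simp)).clm_apply continuous_const

lemma contDiff_lapl {f : ℝ × ℝ → F} (hf : ContDiff ℝ (⊤ : ℕ∞) f) :
    ContDiff ℝ (⊤ : ℕ∞) (lapl f) :=
  (contDiff_dd (contDiff_dd hf _) _).add (contDiff_dd (contDiff_dd hf _) _)

lemma differentiable_of_smooth {f : ℝ × ℝ → F} (hf : ContDiff ℝ (⊤ : ℕ∞) f) :
    Differentiable ℝ f := hf.differentiable (by simp)

lemma contDiff_one_of_smooth {E : Type*} [NormedAddCommGroup E] [NormedSpace ℝ E] {f : E → F}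
    (hf : ContDiff ℝ (⊤ : ℕ∞) f) : ContDiff ℝ 1 f := hf.of_le (by exact_mod_cast le_top)

lemma hasDerivAt_line {f : ℝ × ℝ → F} (hf : Differentiable ℝ f) (p v : ℝ × ℝ) (t : ℝ) :
    HasDerivAt (fun s : ℝ => f (p + s • v)) (dd v f (p + t • v)) t := by
  have h : HasDerivAt (fun s : ℝ => p + s • v) v t := by
    simpa using ((hasDerivAt_id t).smul_const v).const_add p
  exact (hf _).hasFDerivAt.comp_hasDerivAt t h

lemma hasDerivAt_fst {f : ℝ × ℝ → F} (hf : Differentiable ℝ f) (a b : ℝ) :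
    HasDerivAt (fun s : ℝ => f (s, b)) (dd e₁ f (a, b)) a := by
  simpa using hasDerivAt_line hf (0, b) e₁ a

lemma hasDerivAt_snd {f : ℝ × ℝ → F} (hf : Differentiable ℝ f) (a b : ℝ) :
    HasDerivAt (fun s : ℝ => f (a, s)) (dd e₂ f (a, b)) b := by
  simpa using hasDerivAt_line hf (a, 0) e₂ b

lemma dd_congr {f g : ℝ × ℝ → F} {p : ℝ × ℝ} (h : f =ᶠ[𝓝 p] g) (v : ℝ × ℝ) :
    dd v f p = dd v g p := by
  simp [dd, h.fderiv_eq]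

lemma dd_add {f g : ℝ × ℝ → F} (hf : Differentiable ℝ f) (hg : Differentiable ℝ g)
    (v p : ℝ × ℝ) : dd v (fun q => f q + g q) p = dd v f p + dd v g p := by
  simp only [dd]; rw [fderiv_fun_add (hf p) (hg p)]; rfl

lemma dd_sub {f g : ℝ × ℝ → F} (hf : Differentiable ℝ f) (hg : Differentiable ℝ g)
    (v p : ℝ × ℝ) : dd v (fun q => f q - g q) p = dd v f p - dd v g p := by
  simp only [dd]; rw [fderiv_fun_sub (hf p) (hg p)]; rfl

lemma dd_mul {f g : ℝ × ℝ → ℝ} (hf : Differentiable ℝ f) (hg : Differentiable ℝ g)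
    (v p : ℝ × ℝ) : dd v (fun q => f q * g q) p = f p * dd v g p + dd v f p * g p := by
  simp only [dd]; rw [fderiv_fun_mul (hf p) (hg p)]
  simp [mul_comm]

lemma dd_comm {f : ℝ × ℝ → F} (hf : ContDiff ℝ (⊤ : ℕ∞) f) (v w p : ℝ × ℝ) :
    dd v (dd w f) p = dd w (dd v f) p := by
  have h1 : DifferentiableAt ℝ (fderiv ℝ f) p :=
    (hf.fderiv_right (m := (⊤ : ℕ∞)) (by simp)).differentiable (by simp) p
  have h2 (a b : ℝ × ℝ) : dd a (dd b f) p = fderiv ℝ (fderiv ℝ f) p a b := by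
    have : fderiv ℝ (fun q => fderiv ℝ f q b) p = _ :=
      (h1.hasFDerivAt.clm_apply (hasFDerivAt_const b p)).fderiv
    change fderiv ℝ (fun q => fderiv ℝ f q b) p a = _
    rw [this]; simp
  rw [h2, h2]
  exact (hf.contDiffAt.isSymmSndFDerivAt (by
    simp only [minSmoothness_of_isRCLikeNormedField]
    exact WithTop.coe_le_coe.2 (le_top : (2 : ℕ∞) ≤ ⊤))) v w

lemma dd_comp_real {f : ℝ × ℝ → ℝ} (hf : Differentiable ℝ f) {g g' : ℝ → ℝ}
    {p : ℝ × ℝ} (hg : HasDerivAt g (g' (f p)) (f p)) (v : ℝ × ℝ) :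
    dd v (fun q => g (f q)) p = g' (f p) * dd v f p := by
  have := (hg.comp_hasFDerivAt p (hf p).hasFDerivAt).fderiv
  simp only [dd]
  change (fderiv ℝ (g ∘ f) p) v = _
  rw [this]; simp

lemma dd_inner {H : Type*} [NormedAddCommGroup H] [InnerProductSpace ℝ H] {f g : ℝ × ℝ → H}
    (hf : Differentiable ℝ f) (hg : Differentiable ℝ g) (v p : ℝ × ℝ) :
    dd v (fun q => ⟪f q, g q⟫) p = ⟪f p, dd v g p⟫ + ⟪dd v f p, g p⟫ := by
  simp only [dd]; rw [fderiv_inner_apply _ (hf p) (hg p)]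

lemma dd_comp {G : Type*} [NormedAddCommGroup G] [NormedSpace ℝ G] {g : F → G} {f : ℝ × ℝ → F}
    (hg : Differentiable ℝ g) (hf : Differentiable ℝ f) (v p : ℝ × ℝ) :
    dd v (fun q => g (f q)) p = fderiv ℝ g (f p) (dd v f p) := by
  simp only [dd]
  change fderiv ℝ (g ∘ f) p v = _
  rw [fderiv_comp p (hg _) (hf p)]; rfl

lemma continuous_hasCompactSupport_integrable {f : ℝ × ℝ → ℝ} (hf : Continuous f)
    {r : ℝ} (h : ∀ p, p ∉ Sq r → f p = 0) : Integrable f :=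
  hf.integrable_of_hasCompactSupport (HasCompactSupport.intro (isCompact_Sq r) h)

lemma dd_eq_zero_of_notMem {f : ℝ × ℝ → F} {r : ℝ} (h : ∀ p, p ∉ Sq r → f p = 0) (v : ℝ × ℝ) :
    ∀ p, p ∉ Sq r → dd v f p = 0 := by
  intro p hp
  have h1 : f =ᶠ[𝓝 p] fun _ => 0 := by
    filter_upwards [(isCompact_Sq r).isClosed.isOpen_compl.mem_nhds hp] with q hq using h q hq
  rw [dd_congr h1]; simp [dd]

/-- Integration by parts against a compactly supported function. -/
lemma integral_mul_dd {f g : ℝ × ℝ → ℝ} (hf : ContDiff ℝ 1 f) (hg : ContDiff ℝ 1 g)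
    {r : ℝ} (h : ∀ p, p ∉ Sq r → f p = 0) (v : ℝ × ℝ) :
    ∫ p, f p * dd v g p = - ∫ p, dd v f p * g p := by
  have hd := dd_eq_zero_of_notMem h v
  refine integral_mul_fderiv_eq_neg_fderiv_mul_of_integrable ?_ ?_ ?_
    (fun x _ => hf.differentiable (by simp) x) (fun x _ => hg.differentiable (by simp) x)
  · exact continuous_hasCompactSupport_integrable ((continuous_dd hf v).mul hg.continuous)
      (r := r) fun p hp => by change dd v f p * g p = 0; rw [hd p hp, zero_mul]
  · exact continuous_hasCompactSupport_integrable (hf.continuous.mul (continuous_dd hg v))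
      (r := r) fun p hp => by rw [h p hp, zero_mul]
  · exact continuous_hasCompactSupport_integrable (hf.continuous.mul hg.continuous)
      (r := r) fun p hp => by rw [h p hp, zero_mul]

lemma integral_mul_lapl {f g : ℝ × ℝ → ℝ} (hf : ContDiff ℝ (⊤ : ℕ∞) f)
    (hg : ContDiff ℝ (⊤ : ℕ∞) g) {r : ℝ} (h : ∀ p, p ∉ Sq r → f p = 0) :
    ∫ p, f p * lapl g p = ∫ p, lapl f p * g p := by
  have key (v : ℝ × ℝ) : ∫ p, f p * dd v (dd v g) p = ∫ p, dd v (dd v f) p * g p := by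
    rw [integral_mul_dd (contDiff_one_of_smooth hf) (contDiff_one_of_smooth (contDiff_dd hg v)) h,
      integral_mul_dd (contDiff_one_of_smooth (contDiff_dd hf v)) (contDiff_one_of_smooth hg)
      (dd_eq_zero_of_notMem h v), neg_neg]
  have i1 (v : ℝ × ℝ) : Integrable fun p => f p * dd v (dd v g) p :=
    continuous_hasCompactSupport_integrable
      (hf.continuous.mul (contDiff_dd (contDiff_dd hg v) v).continuous)
      (r := r) fun p hp => by rw [h p hp, zero_mul]
  have i2 (v : ℝ × ℝ) : Integrable fun p => dd v (dd v f) p * g p :=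
    continuous_hasCompactSupport_integrable
      ((contDiff_dd (contDiff_dd hf v) v).continuous.mul hg.continuous)
      (r := r) fun p hp => by
        rw [dd_eq_zero_of_notMem (dd_eq_zero_of_notMem h v) v p hp, zero_mul]
  simp only [lapl, mul_add, add_mul]
  rw [integral_add (i1 _) (i1 _), integral_add (i2 _) (i2 _), key, key]

end PlaneCalculus

end AllenCahn

namespace AllenCahn

/-- A smooth cutoff, equal to one on `Sq (3 / 4 * r)`, supported in `Sq r`, with Laplacian
of size `r⁻²`. -/
lemma exists_cutoff : ∃ C > (0 : ℝ), ∀ r > (0 : ℝ), ∃ ψ : ℝ × ℝ → ℝ, ContDiff ℝ (⊤ : ℕ∞) ψ ∧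
    (∀ p, 0 ≤ ψ p) ∧ (∀ p, ψ p ≤ 1) ∧ (∀ p ∈ Sq (3 / 4 * r), ψ p = 1) ∧
    (∀ p, p ∉ Sq r → ψ p = 0) ∧ ∀ p, |lapl ψ p| ≤ C / r ^ 2 := by
  let b : ContDiffBump (0 : ℝ × ℝ) := ⟨3 / 4, 1, by norm_num, by norm_num⟩
  have hb : ContDiff ℝ (⊤ : ℕ∞) b := b.contDiff
  have hb0 : ∀ p, p ∉ Sq 1 → b p = 0 := fun p hp => by
    apply b.zero_of_le_dist
    simp only [Sq, mem_closedBall, not_le] at hp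
    exact hp.le
  have hl0 : ∀ p, p ∉ Sq 1 → lapl b p = 0 := fun p hp => by
    simp only [lapl]
    rw [dd_eq_zero_of_notMem (dd_eq_zero_of_notMem hb0 _) _ p hp,
      dd_eq_zero_of_notMem (dd_eq_zero_of_notMem hb0 _) _ p hp, add_zero]
  obtain ⟨C, hC⟩ := (isCompact_Sq 1).exists_bound_of_continuousOn
    (contDiff_lapl hb).continuous.continuousOn
  refine ⟨|C| + 1, by positivity, fun r hr => ⟨fun p => b (r⁻¹ • p), ?_, fun p => b.nonneg,
    fun p => b.le_one, ?_, ?_, ?_⟩⟩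
  · exact hb.comp (contDiff_const_smul _)
  · intro p hp
    apply b.one_of_mem_closedBall
    simp only [Sq, mem_closedBall, dist_zero_right] at hp ⊢
    rw [norm_smul, Real.norm_of_nonneg (by positivity)]
    change r⁻¹ * ‖p‖ ≤ 3 / 4
    rw [inv_mul_le_iff₀ hr]; linarith
  · intro p hp
    apply hb0
    simp only [Sq, mem_closedBall, dist_zero_right, not_le] at hp ⊢
    rw [norm_smul, Real.norm_of_nonneg (by positivity), lt_inv_mul_iff₀ hr]; linarith
  · intro p
    have hs {f : ℝ × ℝ → ℝ} (hf : ContDiff ℝ (⊤ : ℕ∞) f) (v : ℝ × ℝ) :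
        dd v (fun p => f (r⁻¹ • p)) = fun p => r⁻¹ * dd v f (r⁻¹ • p) := by
      funext p
      have h1 : HasFDerivAt (fun p : ℝ × ℝ => r⁻¹ • p) (r⁻¹ • ContinuousLinearMap.id ℝ (ℝ × ℝ)) p :=
        (r⁻¹ • ContinuousLinearMap.id ℝ (ℝ × ℝ)).hasFDerivAt
      have := ((differentiable_of_smooth hf (r⁻¹ • p)).hasFDerivAt.comp p h1).fderiv
      simp only [dd]
      change fderiv ℝ (f ∘ fun p : ℝ × ℝ => r⁻¹ • p) p v = _
      rw [this]; simp
    have hs2 (v : ℝ × ℝ) : dd v (dd v (fun p => b (r⁻¹ • p))) p =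
        r⁻¹ * (r⁻¹ * dd v (dd v b) (r⁻¹ • p)) := by
      rw [hs hb]
      have : dd v (fun q => r⁻¹ * dd v b (r⁻¹ • q)) p =
          r⁻¹ * dd v (fun q => dd v b (r⁻¹ • q)) p := by
        simp only [dd]
        rw [fderiv_const_mul]
        · simp
        · exact (differentiable_of_smooth (contDiff_dd hb v)).differentiableAt.comp p
            (by fun_prop)
      rw [this, hs (contDiff_dd hb v)]
    have : lapl (fun p => b (r⁻¹ • p)) p = lapl b (r⁻¹ • p) / r ^ 2 := by
      simp only [lapl, hs2]; field_simp
    rw [this, abs_div, abs_of_pos (show 0 < r ^ 2 by positivity)]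
    gcongr
    by_cases hp : r⁻¹ • p ∈ Sq 1
    · exact (hC _ hp).trans ((le_abs_self C).trans (by linarith))
    · rw [hl0 _ hp]; simp; positivity

lemma lapl_comp_real {f : ℝ × ℝ → ℝ} (hf : ContDiff ℝ (⊤ : ℕ∞) f) {g g' g'' : ℝ → ℝ}
    (hg : ∀ p, HasDerivAt g (g' (f p)) (f p)) (hg' : ∀ p, HasDerivAt g' (g'' (f p)) (f p))
    (hd : Differentiable ℝ fun p => g' (f p)) (p : ℝ × ℝ) :
    lapl (fun q => g (f q)) p =
      g' (f p) * lapl f p + g'' (f p) * ((dd e₁ f p) ^ 2 + (dd e₂ f p) ^ 2) := by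
  have hf1 := differentiable_of_smooth hf
  have key (v : ℝ × ℝ) : dd v (dd v fun q => g (f q)) p =
      g' (f p) * dd v (dd v f) p + g'' (f p) * (dd v f p) ^ 2 := by
    have h1 : (dd v fun q => g (f q)) = fun q => g' (f q) * dd v f q :=
      funext fun q => dd_comp_real hf1 (hg q) v
    rw [h1, dd_mul hd (differentiable_of_smooth (contDiff_dd hf v)), dd_comp_real hf1 (hg' p) v]
    ring
  simp only [lapl, key]; ring

/-- At an interior maximum the second derivative is nonpositive. -/
lemma deriv2_nonpos_of_isLocalMax {g g' : ℝ → ℝ} {g'' t : ℝ} (hg : ∀ s, HasDerivAt g (g' s) s)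
    (hg' : HasDerivAt g' g'' t) (hm : IsLocalMax g t) : g'' ≤ 0 := by
  by_contra! hpos
  have hd : deriv g = g' := funext fun s => (hg s).deriv
  have h1 : IsLocalMin g t := isLocalMin_of_deriv_deriv_pos (by rwa [hd, hg'.deriv])
    (hm.deriv_eq_zero) (hg t).continuousAt
  have h2 : g =ᶠ[𝓝 t] fun _ => g t := by
    filter_upwards [hm, h1] with s a b using le_antisymm a b
  have h3 : g' =ᶠ[𝓝 t] fun _ => 0 := by
    filter_upwards [h2.eventuallyEq_nhds] with s hs
    rw [← (hg s).deriv, hs.deriv_eq]; simp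
  have h4 : g'' = 0 := by rw [← hg'.deriv, h3.deriv_eq]; simp
  linarith

/-- Strict weak maximum principle on a rectangle. -/
lemma max_principle {H : ℝ × ℝ → ℝ} (hH : ContDiff ℝ (⊤ : ℕ∞) H) {a b c d : ℝ}
    (hlap : ∀ p ∈ Set.Ioo a b ×ˢ Set.Ioo c d, 0 < lapl H p)
    (hbd : ∀ p ∈ Set.Icc a b ×ˢ Set.Icc c d, p ∉ Set.Ioo a b ×ˢ Set.Ioo c d → H p ≤ 0) :
    ∀ p ∈ Set.Icc a b ×ˢ Set.Icc c d, H p ≤ 0 := by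
  intro p hp
  obtain ⟨q, hq, hmax⟩ := (isCompact_Icc.prod isCompact_Icc).exists_isMaxOn ⟨p, hp⟩
    hH.continuous.continuousOn
  refine (hmax hp).trans ?_
  by_cases hqi : q ∈ Set.Ioo a b ×ˢ Set.Ioo c d
  · exfalso
    have hloc : IsLocalMax H q := by
      refine hmax.isLocalMax ?_
      exact mem_of_superset ((isOpen_Ioo.prod isOpen_Ioo).mem_nhds hqi)
        (Set.prod_mono Set.Ioo_subset_Icc_self Set.Ioo_subset_Icc_self)
    have h2 (v : ℝ × ℝ) : dd v (dd v H) q ≤ 0 := by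
      have hc : ContinuousAt (fun s : ℝ => q + s • v) 0 := by fun_prop
      have := hasDerivAt_line (differentiable_of_smooth (contDiff_dd hH v)) q v 0
      rw [zero_smul, add_zero] at this
      refine deriv2_nonpos_of_isLocalMax
        (hasDerivAt_line (differentiable_of_smooth hH) q v) this ?_
      have h3 : ∀ᶠ z in 𝓝 (q + (0 : ℝ) • v), H z ≤ H q := by
        rw [zero_smul, add_zero]; exact hloc
      filter_upwards [hc.eventually h3] with s hs
      simpa using hs
    have := hlap q hqi
    simp only [lapl] at this
    linarith [h2 e₁, h2 e₂]
  · exact hbd q hq hqi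

end AllenCahn

namespace AllenCahn

lemma dd_fst_eq {F : Type*} [NormedAddCommGroup F] [NormedSpace ℝ F] {f : ℝ × ℝ → F}
    (hf : Differentiable ℝ f) {f' : F} {p : ℝ × ℝ}
    (h : HasDerivAt (fun s => f (s, p.2)) f' p.1) : dd e₁ f p = f' :=
  (hasDerivAt_fst hf p.1 p.2).unique h

lemma dd_snd_eq {F : Type*} [NormedAddCommGroup F] [NormedSpace ℝ F] {f : ℝ × ℝ → F}
    (hf : Differentiable ℝ f) {f' : F} {p : ℝ × ℝ}
    (h : HasDerivAt (fun s => f (p.1, s)) f' p.2) : dd e₂ f p = f' :=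
  (hasDerivAt_snd hf p.1 p.2).unique h

/-- Interior gradient estimate for the Poisson equation, by comparison with a quadratic
barrier on a half-square. -/
lemma gradient_estimate_snd {f : ℝ × ℝ → ℝ} (hf : ContDiff ℝ (⊤ : ℕ∞) f) {d M N : ℝ} (hd : 0 < d)
    (hM : ∀ p ∈ Sq d, |f p| ≤ M) (hN : ∀ p ∈ Sq d, |lapl f p| ≤ N) :
    dd e₂ f 0 ≤ 2 * M / d + (N + 1) * d / 2 := by
  have hM0 : 0 ≤ M := (abs_nonneg _).trans (hM 0 (by simp [mem_Sq, hd.le]))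
  have hN0 : 0 ≤ N := (abs_nonneg _).trans (hN 0 (by simp [mem_Sq, hd.le]))
  set H : ℝ × ℝ → ℝ := fun p => (f (p.1, p.2) - f (p.1, -p.2)) / 2
    - M / d ^ 2 * (p.1 ^ 2 + p.2 * (2 * d - p.2)) - (N + 1) / 2 * (p.2 * (d - p.2)) with hHdef
  have hH : ContDiff ℝ (⊤ : ℕ∞) H := by
    have h1 : ContDiff ℝ (⊤ : ℕ∞) fun p : ℝ × ℝ => f (p.1, -p.2) :=
      hf.comp (contDiff_fst.prodMk contDiff_snd.neg)
    have h2 : ContDiff ℝ (⊤ : ℕ∞) fun p : ℝ × ℝ => f (p.1, p.2) := hf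
    fun_prop
  have hf1 := differentiable_of_smooth hf
  have hfx := differentiable_of_smooth (contDiff_dd hf e₁)
  have hfy := differentiable_of_smooth (contDiff_dd hf e₂)
  have hneg {g : ℝ × ℝ → ℝ} (hg : Differentiable ℝ g) (a b : ℝ) :
      HasDerivAt (fun s => g (a, -s)) (- dd e₂ g (a, -b)) b := by
    simpa [Function.comp_def] using
      (hasDerivAt_snd hg a (-b)).comp b (hasDerivAt_neg b)
  have hsub (b : ℝ) (c : ℝ) : HasDerivAt (fun s : ℝ => s * (c - s)) (c - 2 * b) b := by
    exact ((hasDerivAt_id b).mul ((hasDerivAt_const b c).sub (hasDerivAt_id b))).congr_deriv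
      (by simp; ring)
  have h1 : dd e₁ H = fun p => (dd e₁ f (p.1, p.2) - dd e₁ f (p.1, -p.2)) / 2
      - M / d ^ 2 * (2 * p.1) := by
    funext p
    refine dd_fst_eq (differentiable_of_smooth hH) ?_
    have := ((((hasDerivAt_fst hf1 p.1 p.2).sub (hasDerivAt_fst hf1 p.1 (-p.2))).div_const 2).sub
      (((hasDerivAt_pow 2 p.1).add_const (p.2 * (2 * d - p.2))).const_mul (M / d ^ 2))).sub_const
        ((N + 1) / 2 * (p.2 * (d - p.2)))
    exact this.congr_deriv (by simp)
  have h2 : dd e₂ H = fun p => (dd e₂ f (p.1, p.2) + dd e₂ f (p.1, -p.2)) / 2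
      - M / d ^ 2 * (2 * d - 2 * p.2) - (N + 1) / 2 * (d - 2 * p.2) := by
    funext p
    refine dd_snd_eq (differentiable_of_smooth hH) ?_
    have := ((((hasDerivAt_snd hf1 p.1 p.2).sub (hneg hf1 p.1 p.2)).div_const 2).sub
      (((hsub p.2 (2 * d)).const_add (p.1 ^ 2)).const_mul (M / d ^ 2))).sub
        ((hsub p.2 d).const_mul ((N + 1) / 2))
    exact this.congr_deriv (by ring)
  have h11 (p : ℝ × ℝ) : dd e₁ (dd e₁ H) p =
      (dd e₁ (dd e₁ f) (p.1, p.2) - dd e₁ (dd e₁ f) (p.1, -p.2)) / 2 - M / d ^ 2 * 2 := by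
    refine dd_fst_eq (differentiable_of_smooth (contDiff_dd hH _)) ?_
    rw [h1]
    have := (((hasDerivAt_fst hfx p.1 p.2).sub (hasDerivAt_fst hfx p.1 (-p.2))).div_const 2).sub
      (((hasDerivAt_id p.1).const_mul 2).const_mul (M / d ^ 2))
    exact this.congr_deriv (by simp)
  have h22 (p : ℝ × ℝ) : dd e₂ (dd e₂ H) p =
      (dd e₂ (dd e₂ f) (p.1, p.2) - dd e₂ (dd e₂ f) (p.1, -p.2)) / 2 + M / d ^ 2 * 2
        + (N + 1) := by
    refine dd_snd_eq (differentiable_of_smooth (contDiff_dd hH _)) ?_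
    rw [h2]
    have := ((((hasDerivAt_snd hfy p.1 p.2).add (hneg hfy p.1 p.2)).div_const 2).sub
      ((((hasDerivAt_id p.2).const_mul 2).const_sub (2 * d)).const_mul (M / d ^ 2))).sub
      ((((hasDerivAt_id p.2).const_mul 2).const_sub d).const_mul ((N + 1) / 2))
    exact this.congr_deriv (by simp; ring)
  have hle : ∀ p ∈ Set.Icc (-d) d ×ˢ Set.Icc 0 d, H p ≤ 0 := by
    refine max_principle hH ?_ ?_
    · rintro ⟨x, y⟩ ⟨hx, hy⟩
      simp only [Set.mem_Ioo] at hx hy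
      have a1 := abs_le.1 (hN (x, y) (mem_Sq.2 ⟨abs_le.2 ⟨hx.1.le, hx.2.le⟩,
        abs_le.2 ⟨by simp only; linarith, hy.2.le⟩⟩))
      have a2 := abs_le.1 (hN (x, -y) (mem_Sq.2 ⟨abs_le.2 ⟨hx.1.le, hx.2.le⟩,
        abs_le.2 ⟨by simp only; linarith, by simp only; linarith⟩⟩))
      simp only [lapl, h11, h22] at a1 a2 ⊢
      linarith
    · rintro ⟨x, y⟩ ⟨hx, hy⟩ hn
      simp only [Set.mem_Icc] at hx hy
      have b1 := abs_le.1 (hM (x, y) (mem_Sq.2 ⟨abs_le.2 hx,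
        abs_le.2 ⟨by simp only; linarith, hy.2⟩⟩))
      have b2 := abs_le.1 (hM (x, -y) (mem_Sq.2 ⟨abs_le.2 hx,
        abs_le.2 ⟨by simp only; linarith, by simp only; linarith⟩⟩))
      have c1 : 0 ≤ (N + 1) / 2 * (y * (d - y)) :=
        mul_nonneg (by linarith) (mul_nonneg hy.1 (by linarith [hy.2]))
      simp only [hHdef]
      rcases eq_or_lt_of_le hy.1 with h0 | h0
      · subst h0
        have : 0 ≤ M / d ^ 2 * x ^ 2 := by positivity
        simp; linarith
      · have hq : d ^ 2 ≤ x ^ 2 + y * (2 * d - y) := by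
          by_cases hyd : y = d
          · subst hyd; nlinarith
          · have hyd' : y < d := lt_of_le_of_ne hy.2 hyd
            have hx' : x = -d ∨ x = d := by
              by_contra! hc
              exact hn ⟨⟨lt_of_le_of_ne hx.1 (Ne.symm hc.1), lt_of_le_of_ne hx.2 hc.2⟩, h0, hyd'⟩
            have : x ^ 2 = d ^ 2 := by rcases hx' with h | h <;> rw [h]; ring
            nlinarith
        have : M ≤ M / d ^ 2 * (x ^ 2 + y * (2 * d - y)) := by
          calc M = M / d ^ 2 * d ^ 2 := by field_simp
            _ ≤ _ := by gcongr
        linarith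
  have hder : HasDerivAt (fun s => H (0, s)) (dd e₂ H 0) 0 :=
    hasDerivAt_snd (differentiable_of_smooth hH) 0 0
  have hH0 : H (0, 0) = 0 := by simp [hHdef]
  have hfin : dd e₂ H 0 ≤ 0 := by
    by_contra! hpos
    have hs := hasDerivAt_iff_tendsto_slope_zero.1 hder
    have hs2 : Tendsto (fun t : ℝ => t⁻¹ • (H (0, 0 + t) - H (0, 0))) (𝓝[>] 0) (𝓝 (dd e₂ H 0)) :=
      hs.mono_left (nhdsWithin_mono _ fun t ht => ne_of_gt ht)
    have hs3 := hs2.eventually (lt_mem_nhds hpos)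
    obtain ⟨t, ht1, ht2⟩ := (hs3.and (Ioo_mem_nhdsGT hd)).exists
    rw [hH0, zero_add, sub_zero, smul_eq_mul] at ht1
    have := hle (0, t) ⟨⟨by simp only; linarith, hd.le⟩, ht2.1.le, ht2.2.le⟩
    have h3 : 0 < t⁻¹ := inv_pos.2 ht2.1
    nlinarith
  rw [h2] at hfin
  simp only [Prod.fst_zero, Prod.snd_zero, neg_zero, mul_zero, sub_zero] at hfin
  have e0 : ((0 : ℝ), (0 : ℝ)) = 0 := rfl
  rw [e0] at hfin
  have : M / d ^ 2 * (2 * d) = 2 * M / d := by field_simp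
  linarith

lemma lapl_inner_const {H : Type*} [NormedAddCommGroup H] [InnerProductSpace ℝ H]
    {U : ℝ × ℝ → H} (hU : ContDiff ℝ (⊤ : ℕ∞) U) (ξ : H) (p : ℝ × ℝ) :
    lapl (fun q => ⟪ξ, U q⟫) p = ⟪ξ, lapl U p⟫ := by
  have key {W : ℝ × ℝ → H} (hW : ContDiff ℝ (⊤ : ℕ∞) W) (v : ℝ × ℝ) :
      dd v (fun q => ⟪ξ, W q⟫) = fun q => ⟪ξ, dd v W q⟫ := by
    funext q
    rw [dd_inner (differentiable_const ξ) (differentiable_of_smooth hW)]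
    simp [dd]
  simp only [lapl, key hU, key (contDiff_dd hU _), inner_add_right]

lemma dd_translate {F : Type*} [NormedAddCommGroup F] [NormedSpace ℝ F] (f : ℝ × ℝ → F)
    (z v : ℝ × ℝ) : dd v (fun q => f (z + q)) = fun q => dd v f (z + q) := by
  funext q; simp only [dd]; rw [fderiv_comp_add_left]

lemma lapl_translate {F : Type*} [NormedAddCommGroup F] [NormedSpace ℝ F] (f : ℝ × ℝ → F)
    (z : ℝ × ℝ) : lapl (fun q => f (z + q)) = fun q => lapl f (z + q) := by
  funext q
  simp only [lapl, dd_translate]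

lemma dd_swap {F : Type*} [NormedAddCommGroup F] [NormedSpace ℝ F] {f : ℝ × ℝ → F}
    (hf : Differentiable ℝ f) (v : ℝ × ℝ) :
    dd v (fun q => f q.swap) = fun q => dd v.swap f q.swap := by
  funext q
  have h : HasFDerivAt (Prod.swap : ℝ × ℝ → ℝ × ℝ)
      (ContinuousLinearEquiv.prodComm ℝ ℝ ℝ : ℝ × ℝ →L[ℝ] ℝ × ℝ) q :=
    (ContinuousLinearEquiv.prodComm ℝ ℝ ℝ : ℝ × ℝ →L[ℝ] ℝ × ℝ).hasFDerivAt
  have := ((hf q.swap).hasFDerivAt.comp q h).fderiv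
  simp only [dd]
  change fderiv ℝ (f ∘ Prod.swap) q v = _
  rw [this]; rfl

lemma contDiff_swap {F : Type*} [NormedAddCommGroup F] [NormedSpace ℝ F] {f : ℝ × ℝ → F}
    (hf : ContDiff ℝ (⊤ : ℕ∞) f) : ContDiff ℝ (⊤ : ℕ∞) fun q : ℝ × ℝ => f q.swap :=
  hf.comp (contDiff_snd.prodMk contDiff_fst)

lemma lapl_swap {F : Type*} [NormedAddCommGroup F] [NormedSpace ℝ F] {f : ℝ × ℝ → F}
    (hf : ContDiff ℝ (⊤ : ℕ∞) f) :
    lapl (fun q => f q.swap) = fun q => lapl f q.swap := by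
  funext q
  simp only [lapl, dd_swap (differentiable_of_smooth hf)]
  rw [dd_swap (differentiable_of_smooth (contDiff_dd hf _)),
    dd_swap (differentiable_of_smooth (contDiff_dd hf _))]
  simp [add_comm]

lemma swap_mem_Sq {p : ℝ × ℝ} {r : ℝ} : p.swap ∈ Sq r ↔ p ∈ Sq r := by
  simp [mem_Sq, and_comm]

lemma norm_dd_snd_le {H : Type*} [NormedAddCommGroup H] [InnerProductSpace ℝ H]
    {U : ℝ × ℝ → H} (hU : ContDiff ℝ (⊤ : ℕ∞) U) {d M N : ℝ} (hd : 0 < d) (z : ℝ × ℝ)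
    (hM : ∀ p ∈ Sq d, ‖U (z + p)‖ ≤ M) (hN : ∀ p ∈ Sq d, ‖lapl U (z + p)‖ ≤ N) :
    ‖dd e₂ U z‖ ≤ 2 * M / d + (N + 1) * d / 2 := by
  by_cases h0 : dd e₂ U z = 0
  · have hM0 : 0 ≤ M := (norm_nonneg _).trans (hM 0 (by simp [mem_Sq, hd.le]))
    have hN0 : 0 ≤ N := (norm_nonneg _).trans (hN 0 (by simp [mem_Sq, hd.le]))
    rw [h0, norm_zero]; positivity
  set W : ℝ × ℝ → H := fun q => U (z + q)
  have hW : ContDiff ℝ (⊤ : ℕ∞) W := hU.comp (contDiff_const.add contDiff_id)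
  set ξ : H := ‖dd e₂ U z‖⁻¹ • dd e₂ U z
  have hξ : ‖ξ‖ = 1 := norm_smul_inv_norm (𝕜 := ℝ) h0
  have hb (w : H) {c : ℝ} (hw : ‖w‖ ≤ c) : |⟪ξ, w⟫| ≤ c := by
    have := abs_real_inner_le_norm ξ w
    rw [hξ, one_mul] at this; exact this.trans hw
  have := gradient_estimate_snd (f := fun q => ⟪ξ, W q⟫) (contDiff_const.inner ℝ hW) hd
    (fun p hp => hb _ (hM p hp)) (fun p hp => by
      rw [lapl_inner_const hW, lapl_translate]; exact hb _ (hN p hp))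
  rw [dd_inner (differentiable_const ξ) (differentiable_of_smooth hW), dd_translate] at this
  simp only [add_zero] at this
  have h1 : dd e₂ (fun _ : ℝ × ℝ => ξ) 0 = 0 := by simp [dd]
  rw [h1, inner_zero_left, add_zero] at this
  have h2 : ⟪ξ, dd e₂ U z⟫ = ‖dd e₂ U z‖ := by
    simp only [ξ]
    rw [real_inner_smul_left, real_inner_self_eq_norm_sq]
    field_simp
  rwa [h2] at this

lemma norm_dd_fst_le {H : Type*} [NormedAddCommGroup H] [InnerProductSpace ℝ H]
    {U : ℝ × ℝ → H} (hU : ContDiff ℝ (⊤ : ℕ∞) U) {d M N : ℝ} (hd : 0 < d) (z : ℝ × ℝ)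
    (hM : ∀ p ∈ Sq d, ‖U (z + p)‖ ≤ M) (hN : ∀ p ∈ Sq d, ‖lapl U (z + p)‖ ≤ N) :
    ‖dd e₁ U z‖ ≤ 2 * M / d + (N + 1) * d / 2 := by
  have h := norm_dd_snd_le (contDiff_swap hU) hd z.swap (M := M) (N := N)
    (fun p hp => hM p.swap (swap_mem_Sq.2 hp))
    (fun p hp => by rw [lapl_swap hU]; exact hN p.swap (swap_mem_Sq.2 hp))
  rw [dd_swap (differentiable_of_smooth hU)] at h
  simpa using h

end AllenCahn

namespace AllenCahn

lemma apply_eq_dd {F : Type*} [NormedAddCommGroup F] [NormedSpace ℝ F] (f : ℝ × ℝ → F)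
    (q p : ℝ × ℝ) : fderiv ℝ f q p = p.1 • dd e₁ f q + p.2 • dd e₂ f q := by
  have : p = p.1 • e₁ + p.2 • e₂ := by ext <;> simp
  conv_lhs => rw [this]
  simp only [map_add, map_smul, dd]

lemma dd_scale {F : Type*} [NormedAddCommGroup F] [NormedSpace ℝ F] {f : ℝ × ℝ → F}
    (hf : Differentiable ℝ f) (s : ℝ) (v : ℝ × ℝ) :
    dd v (fun q => f (s • q)) = fun q => s • dd v f (s • q) := by
  funext q
  have h : HasFDerivAt (fun q : ℝ × ℝ => s • q) (s • ContinuousLinearMap.id ℝ (ℝ × ℝ)) q :=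
    (hasFDerivAt_id q).const_smul s
  have := ((hf (s • q)).hasFDerivAt.comp q h).fderiv
  simp only [dd]
  change fderiv ℝ (f ∘ fun q => s • q) q v = _
  rw [this]; simp

lemma lapl_scale {F : Type*} [NormedAddCommGroup F] [NormedSpace ℝ F] {f : ℝ × ℝ → F}
    (hf : ContDiff ℝ (⊤ : ℕ∞) f) (s : ℝ) :
    lapl (fun q => f (s • q)) = fun q => s ^ 2 • lapl f (s • q) := by
  have key (v : ℝ × ℝ) : dd v (dd v (fun q => f (s • q))) =
      fun q => s ^ 2 • dd v (dd v f) (s • q) := by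
    rw [dd_scale (differentiable_of_smooth hf)]
    funext q
    have hc : ContDiff ℝ (⊤ : ℕ∞) fun q : ℝ × ℝ => dd v f (s • q) :=
      (contDiff_dd hf v).comp (contDiff_const_smul s)
    have : dd v (fun q => s • dd v f (s • q)) q = s • dd v (fun q => dd v f (s • q)) q := by
      change fderiv ℝ (fun q => s • dd v f (s • q)) q v = _
      rw [fderiv_fun_const_smul (differentiable_of_smooth hc q)]; rfl
    rw [this, dd_scale (differentiable_of_smooth (contDiff_dd hf v)), smul_smul, sq]
  funext q
  simp only [lapl, key, smul_add]

/-- A weighted mean value inequality for subharmonic functions. -/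
lemma mean_value_weight : ∃ k : ℝ × ℝ → ℝ, Continuous k ∧ (∀ p, 0 ≤ k p) ∧
    (∀ p, p ∉ Sq 1 → k p = 0) ∧ 0 < ∫ p, k p ∧
    ∀ W : ℝ × ℝ → ℝ, ContDiff ℝ (⊤ : ℕ∞) W → (∀ p ∈ Sq 1, 0 ≤ lapl W p) →
      W 0 * ∫ p, k p ≤ ∫ p, W p * k p := by
  set g : ℝ → ℝ := fun t => Real.smoothTransition (1 - t)
  have hg : ContDiff ℝ (⊤ : ℕ∞) g := Real.smoothTransition.contDiff.comp (by fun_prop)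
  have hgd : Differentiable ℝ g := hg.differentiable (by simp)
  have hanti : Antitone g := fun s t h => Real.smoothTransition.monotone (by linarith)
  have hg1 : ∀ t, 1 ≤ t → g t = 0 := fun t ht =>
    Real.smoothTransition.zero_of_nonpos (by linarith)
  have hg0 : g 0 = 1 := Real.smoothTransition.one_of_one_le (by norm_num)
  set N : ℝ × ℝ → ℝ := fun p => p.1 ^ 2 + p.2 ^ 2
  have hN : ContDiff ℝ (⊤ : ℕ∞) N := by fun_prop
  have hNoff : ∀ p, p ∉ Sq 1 → 1 < N p := by
    intro p hp
    rw [mem_Sq, not_and_or, not_le, not_le] at hp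
    simp only [N]
    rcases hp with h | h
    · nlinarith [sq_nonneg p.2, sq_abs p.1]
    · nlinarith [sq_nonneg p.1, sq_abs p.2]
  set Ψ : ℝ × ℝ → ℝ := fun p => g (N p)
  have hΨ : ContDiff ℝ (⊤ : ℕ∞) Ψ := hg.comp hN
  have hΨoff : ∀ p, p ∉ Sq 1 → Ψ p = 0 := fun p hp => hg1 _ (hNoff p hp).le
  have hΨ0 : ∀ p, 0 ≤ Ψ p := fun p => Real.smoothTransition.nonneg _
  have hdg : Continuous (deriv g) := hg.continuous_deriv (by simp)
  set k : ℝ × ℝ → ℝ := fun p => -2 * deriv g (N p)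
  have hk : Continuous k := by
    have := hN.continuous
    fun_prop
  have hk0 : ∀ p, 0 ≤ k p := fun p => by
    have : deriv g (N p) ≤ 0 := hanti.deriv_nonpos
    simp only [k]; linarith
  have hkoff : ∀ p, p ∉ Sq 1 → k p = 0 := by
    intro p hp
    have : g =ᶠ[𝓝 (N p)] fun _ => 0 := by
      filter_upwards [lt_mem_nhds (hNoff p hp)] with t ht using hg1 t ht.le
    simp [k, this.deriv_eq]
  have hkcs : HasCompactSupport k := HasCompactSupport.intro (isCompact_Sq 1) hkoff
  refine ⟨k, hk, hk0, hkoff, ?_, ?_⟩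
  · obtain ⟨t, ht, hdt⟩ := exists_deriv_eq_slope g zero_lt_one hg.continuous.continuousOn
      hgd.differentiableOn
    rw [hg0, hg1 1 le_rfl] at hdt
    have hne : k (Real.sqrt t, 0) ≠ 0 := by
      have : N (Real.sqrt t, 0) = t := by simp [N, Real.sq_sqrt ht.1.le]
      simp only [k, this, hdt]; norm_num
    exact hk.integral_pos_of_hasCompactSupport_nonneg_nonzero hkcs hk0 hne
  intro W hW hlap
  have hWd := differentiable_of_smooth hW
  have hddN1 (p : ℝ × ℝ) : dd e₁ Ψ p = - (p.1 * k p) := by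
    refine dd_fst_eq (differentiable_of_smooth hΨ) ?_
    have h1 : HasDerivAt (fun s : ℝ => s ^ 2 + p.2 ^ 2) (2 * p.1) p.1 := by
      simpa using (hasDerivAt_pow 2 p.1).add_const (p.2 ^ 2)
    exact ((hgd (N p)).hasDerivAt.comp p.1 h1).congr_deriv (by
      change deriv g (N p) * (2 * p.1) = -(p.1 * (-2 * deriv g (N p))); ring)
  have hddN2 (p : ℝ × ℝ) : dd e₂ Ψ p = - (p.2 * k p) := by
    refine dd_snd_eq (differentiable_of_smooth hΨ) ?_
    have h1 : HasDerivAt (fun s : ℝ => p.1 ^ 2 + s ^ 2) (2 * p.2) p.2 := by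
      simpa using (hasDerivAt_pow 2 p.2).const_add (p.1 ^ 2)
    exact ((hgd (N p)).hasDerivAt.comp p.2 h1).congr_deriv (by
      change deriv g (N p) * (2 * p.2) = -(p.2 * (-2 * deriv g (N p))); ring)
  set M : ℝ → ℝ := fun s => ∫ p, W (s • p) * k p
  set M' : ℝ → ℝ := fun s => ∫ p, fderiv ℝ W (s • p) p * k p
  have hfc : Continuous fun x : ℝ × (ℝ × ℝ) => fderiv ℝ W (x.1 • x.2) x.2 * k x.2 := by
    have := hW.continuous_fderiv (by simp)
    fun_prop
  have hM : ∀ s, HasDerivAt M (M' s) s := by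
    intro s
    obtain ⟨B, hB⟩ := ((isCompact_closedBall s 1).prod (isCompact_Sq 1)).exists_bound_of_continuousOn
      hfc.continuousOn
    have hc (t : ℝ) : Continuous fun p : ℝ × ℝ => W (t • p) * k p := by
      have := hW.continuous
      fun_prop
    refine (hasDerivAt_integral_of_dominated_loc_of_deriv_le
      (bound := (Sq 1).indicator fun _ => B) (F' := fun t p => fderiv ℝ W (t • p) p * k p)
      (ball_mem_nhds s one_pos)
      (Eventually.of_forall fun t => (hc t).aestronglyMeasurable) ?_ ?_ ?_ ?_ ?_).2
    · exact continuous_hasCompactSupport_integrable (hc s) (r := 1)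
        fun p hp => by simp [hkoff p hp]
    · exact (hfc.comp (Continuous.prodMk_right s)).aestronglyMeasurable
    · refine Eventually.of_forall fun p t ht => ?_
      by_cases hp : p ∈ Sq 1
      · rw [Set.indicator_of_mem hp]
        exact hB (t, p) ⟨ball_subset_closedBall ht, hp⟩
      · rw [Set.indicator_of_notMem hp, hkoff p hp]; simp
    · exact (integrable_indicator_iff (measurableSet_Sq 1)).2
        (integrableOn_const (isCompact_Sq 1).measure_lt_top.ne)
    · refine Eventually.of_forall fun p t _ => ?_
      have h1 : HasDerivAt (fun t : ℝ => t • p) p t := by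
        simpa using (hasDerivAt_id t).smul_const p
      exact ((hWd (t • p)).hasFDerivAt.comp_hasDerivAt t h1).mul_const (k p)
  have hM'0 : ∀ s ∈ Set.Icc (0 : ℝ) 1, 0 ≤ M' s := by
    intro s hs
    have hcv (v : ℝ × ℝ) : ContDiff ℝ (⊤ : ℕ∞) fun q : ℝ × ℝ => dd v W (s • q) :=
      (contDiff_dd hW v).comp (contDiff_const_smul s)
    have hibp (v : ℝ × ℝ) : ∫ p, dd v Ψ p * dd v W (s • p) =
        - ∫ p, Ψ p * (s * dd v (dd v W) (s • p)) := by
      have := integral_mul_dd (contDiff_one_of_smooth hΨ) (contDiff_one_of_smooth (hcv v)) hΨoff v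
      rw [dd_scale (differentiable_of_smooth (contDiff_dd hW v))] at this
      simp only [smul_eq_mul] at this
      linarith
    have h_int (v : ℝ × ℝ) : Integrable fun p => dd v Ψ p * dd v W (s • p) :=
      continuous_hasCompactSupport_integrable
        ((continuous_dd (contDiff_one_of_smooth hΨ) v).mul (hcv v).continuous)
        (r := 1) fun p hp => by rw [dd_eq_zero_of_notMem hΨoff v p hp, zero_mul]
    have h_int2 (v : ℝ × ℝ) : Integrable fun p => Ψ p * (s * dd v (dd v W) (s • p)) := by
      have := (contDiff_dd (contDiff_dd hW v) v).continuous
      have := hΨ.continuous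
      exact continuous_hasCompactSupport_integrable (by fun_prop)
        (r := 1) fun p hp => by rw [hΨoff p hp, zero_mul]
    have hEq : M' s = ∫ p, Ψ p * (s * lapl W (s • p)) := by
      calc M' s = ∫ p, -(dd e₁ Ψ p * dd e₁ W (s • p) + dd e₂ Ψ p * dd e₂ W (s • p)) := by
            refine integral_congr_ae (Eventually.of_forall fun p => ?_)
            simp only [apply_eq_dd W (s • p) p, hddN1, hddN2, smul_eq_mul]; ring
        _ = ∫ p, (Ψ p * (s * dd e₁ (dd e₁ W) (s • p)) + Ψ p * (s * dd e₂ (dd e₂ W) (s • p))) := by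
            rw [integral_neg, integral_add (h_int _) (h_int _), integral_add (h_int2 _) (h_int2 _),
              hibp, hibp]; ring
        _ = _ := by
            refine integral_congr_ae (Eventually.of_forall fun p => ?_)
            simp only [lapl]; ring
    rw [hEq]
    refine integral_nonneg fun p => ?_
    by_cases hp : p ∈ Sq 1
    · have : s • p ∈ Sq 1 := by
        simp only [Sq, mem_closedBall_zero_iff] at hp ⊢
        rw [norm_smul, Real.norm_of_nonneg hs.1]
        nlinarith [norm_nonneg p, hs.2, hs.1]
      exact mul_nonneg (hΨ0 p) (mul_nonneg hs.1 (hlap _ this))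
    · simp [hΨoff p hp]
  have hmono : MonotoneOn M (Set.Icc 0 1) := by
    refine monotoneOn_of_deriv_nonneg (convex_Icc 0 1)
      (fun s _ => (hM s).continuousAt.continuousWithinAt)
      (fun s _ => (hM s).differentiableAt.differentiableWithinAt) fun s hs => ?_
    rw [(hM s).deriv]
    exact hM'0 s (interior_subset hs)
  have := hmono (Set.left_mem_Icc.2 zero_le_one) (Set.right_mem_Icc.2 zero_le_one) zero_le_one
  simp only [M, zero_smul, one_smul] at this
  rwa [integral_const_mul] at this

lemma setIntegral_scale (f : ℝ × ℝ → ℝ) (z : ℝ × ℝ) {ρ : ℝ} (hρ : 0 < ρ) :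
    ∫ p in Sq 1, f (z + ρ • p) = (ρ ^ 2)⁻¹ * ∫ p in closedBall z ρ, f p := by
  rw [← integral_indicator (measurableSet_Sq 1), ← integral_indicator measurableSet_closedBall]
  have h1 : ∀ p, (Sq 1).indicator (fun p => f (z + ρ • p)) p =
      (fun q => (closedBall z ρ).indicator f (z + q)) (ρ • p) := by
    intro p
    have : p ∈ Sq 1 ↔ z + ρ • p ∈ closedBall z ρ := by
      simp [Sq, mem_closedBall, dist_eq_norm, norm_smul, abs_of_pos hρ, hρ]
    by_cases h : p ∈ Sq 1
    · simp [Set.indicator, h, this.1 h]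
    · simp [Set.indicator, h, mt this.2 h]
  simp_rw [h1]
  rw [Measure.integral_comp_smul volume (fun q => (closedBall z ρ).indicator f (z + q)) ρ,
    integral_add_left_eq_self (μ := volume) ((closedBall z ρ).indicator f) z]
  simp [abs_of_pos hρ]

/-- The mean value inequality for nonnegative subharmonic functions. -/
lemma mean_value_ineq : ∃ C : ℝ, 0 < C ∧ ∀ W : ℝ × ℝ → ℝ, ContDiff ℝ (⊤ : ℕ∞) W →
    ∀ (z : ℝ × ℝ) (ρ : ℝ), 0 < ρ → (∀ p ∈ closedBall z ρ, 0 ≤ W p) →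
    (∀ p ∈ closedBall z ρ, 0 ≤ lapl W p) → W z ≤ C / ρ ^ 2 * ∫ p in closedBall z ρ, W p := by
  obtain ⟨k, hk, hk0, hkoff, hkpos, hmv⟩ := mean_value_weight
  obtain ⟨B, hB⟩ := (isCompact_Sq 1).exists_bound_of_continuousOn hk.continuousOn
  set B' := |B| + 1
  have hB' : 0 < B' := by positivity
  refine ⟨B' / ∫ p, k p, by positivity, fun W hW z ρ hρ h0 hl => ?_⟩
  have hmem {p : ℝ × ℝ} (hp : p ∈ Sq 1) : z + ρ • p ∈ closedBall z ρ := by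
    simp only [Sq, mem_closedBall_zero_iff] at hp
    simp only [mem_closedBall, dist_eq_norm, add_sub_cancel_left, norm_smul,
      Real.norm_of_nonneg hρ.le]
    nlinarith
  have htr : ContDiff ℝ (⊤ : ℕ∞) fun q => W (z + q) := hW.comp (contDiff_const.add contDiff_id)
  have hsm : ContDiff ℝ (⊤ : ℕ∞) fun p : ℝ × ℝ => W (z + ρ • p) :=
    htr.comp (contDiff_const_smul ρ)
  have h1 := hmv _ hsm (fun p hp => by
    rw [lapl_scale htr, lapl_translate]
    exact smul_nonneg (sq_nonneg ρ) (hl _ (hmem hp)))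
  have h2 : ∫ p, W (z + ρ • p) * k p = ∫ p in Sq 1, W (z + ρ • p) * k p := by
    rw [setIntegral_eq_integral_of_forall_compl_eq_zero]
    intro p hp; rw [hkoff p hp, mul_zero]
  have h3 : ∫ p in Sq 1, W (z + ρ • p) * k p ≤ ∫ p in Sq 1, W (z + ρ • p) * B' := by
    have hc := hsm.continuous
    refine setIntegral_mono_on ((hc.mul hk).continuousOn.integrableOn_compact (isCompact_Sq 1))
      ((hc.mul continuous_const).continuousOn.integrableOn_compact (isCompact_Sq 1))
      (measurableSet_Sq 1) fun p hp => ?_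
    · refine mul_le_mul_of_nonneg_left ?_ (h0 _ (hmem hp))
      have := hB p hp
      rw [Real.norm_eq_abs] at this
      linarith [le_abs_self (k p), le_abs_self B]
  rw [h2] at h1
  have h4 := h1.trans h3
  rw [integral_mul_const, setIntegral_scale W z hρ] at h4
  simp only [smul_zero, add_zero] at h4
  rw [show B' / (∫ p, k p) / ρ ^ 2 * ∫ p in closedBall z ρ, W p =
    ((ρ ^ 2)⁻¹ * (∫ p in closedBall z ρ, W p) * B') / ∫ p, k p by field_simp]
  exact (le_div_iff₀ hkpos).2 h4

end AllenCahn

namespace AllenCahn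

section Potential

variable {k : ℕ} {V : Evec k → ℝ}

lemma contDiff_gradient (hV : ContDiff ℝ (⊤ : ℕ∞) V) : ContDiff ℝ (⊤ : ℕ∞) (gradient V) := by
  have h : gradient V = fun y => (InnerProductSpace.toDual ℝ (Evec k)).symm (fderiv ℝ V y) := rfl
  rw [h]
  exact (InnerProductSpace.toDual ℝ (Evec k)).symm.toContinuousLinearEquiv.contDiff.comp
    (hV.fderiv_right (m := (⊤ : ℕ∞)) (by simp))

lemma differentiable_gradient (hV : ContDiff ℝ (⊤ : ℕ∞) V) : Differentiable ℝ (gradient V) :=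
  (contDiff_gradient hV).differentiable (by simp)

lemma hasDerivAt_potential_line (hV : ContDiff ℝ (⊤ : ℕ∞) V) (y ξ : Evec k) (t : ℝ) :
    HasDerivAt (fun s : ℝ => V (y + s • ξ)) ⟪gradient V (y + t • ξ), ξ⟫ t := by
  have h : HasDerivAt (fun s : ℝ => y + s • ξ) ξ t := by
    simpa using ((hasDerivAt_id t).smul_const ξ).const_add y
  rw [inner_gradient_left]
  exact ((hV.differentiable (by simp)) _).hasFDerivAt.comp_hasDerivAt t h

lemma hasDerivAt_gradient_line (hV : ContDiff ℝ (⊤ : ℕ∞) V) (y ξ η : Evec k) (t : ℝ) :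
    HasDerivAt (fun s : ℝ => ⟪gradient V (y + s • ξ), η⟫)
      ⟪fderiv ℝ (gradient V) (y + t • ξ) ξ, η⟫ t := by
  have h : HasDerivAt (fun s : ℝ => y + s • ξ) ξ t := by
    simpa using ((hasDerivAt_id t).smul_const ξ).const_add y
  have h2 := (differentiable_gradient hV (y + t • ξ)).hasFDerivAt.comp_hasDerivAt t h
  simpa using h2.inner ℝ (hasDerivAt_const t η)

lemma inner_fderiv_gradient (hV : ContDiff ℝ (⊤ : ℕ∞) V) (y ξ : Evec k) :
    ⟪fderiv ℝ (gradient V) y ξ, ξ⟫ = iteratedFDeriv ℝ 2 V y ![ξ, ξ] := by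
  rw [iteratedFDeriv_two_apply]
  have h1 := hasDerivAt_gradient_line hV y ξ ξ 0
  have hd : DifferentiableAt ℝ (fderiv ℝ V) y :=
    (hV.fderiv_right (m := (⊤ : ℕ∞)) (by simp)).differentiable (by simp) y
  have h : HasDerivAt (fun s : ℝ => y + s • ξ) ξ 0 := by
    simpa using ((hasDerivAt_id (0 : ℝ)).smul_const ξ).const_add y
  have h2 : HasDerivAt (fun s : ℝ => fderiv ℝ V (y + s • ξ) ξ) (fderiv ℝ (fderiv ℝ V) y ξ ξ) 0 := by
    have hy : y = y + (0 : ℝ) • ξ := by simp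
    have := HasFDerivAt.comp_hasDerivAt (0 : ℝ) (by rw [← hy]; exact hd.hasFDerivAt) h
    simpa using this.clm_apply (hasDerivAt_const (0 : ℝ) ξ)
  simp only [inner_gradient_left, zero_smul, add_zero] at h1
  exact h1.unique h2

lemma gradient_eq_zero_of_zero (h0 : ∀ y, 0 ≤ V y) {σ : Evec k} (hσ : V σ = 0) :
    gradient V σ = 0 := by
  have : IsLocalMin V σ := Eventually.of_forall fun y => by rw [hσ]; exact h0 y
  simp [gradient, this.fderiv_eq_zero]

lemma exists_growth (hV : IsMultiWell V) : ∃ A > (0 : ℝ), ∃ B > (0 : ℝ),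
    (∀ y, ‖y‖ ^ 2 - A ≤ B * V y) ∧ ∀ y, A < ‖y‖ ^ 2 → 0 ≤ ⟪y, gradient V y⟫ := by
  obtain ⟨α, hα, R, hR, hg⟩ := hV.growth
  refine ⟨R ^ 2, by positivity, 2 / α, by positivity, fun y => ?_, fun y hy => ?_⟩
  · rcases le_or_gt (‖y‖) R with h | h
    · have : ‖y‖ ^ 2 ≤ R ^ 2 := by gcongr
      have := hV.nonneg y
      have : 0 ≤ 2 / α * V y := by positivity
      linarith
    set n : Evec k := ‖y‖⁻¹ • y
    have hy0 : 0 < ‖y‖ := hR.trans h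
    have hn : ‖n‖ = 1 := norm_smul_inv_norm (𝕜 := ℝ) (norm_pos_iff.1 hy0)
    have hd (t : ℝ) : HasDerivAt (fun t : ℝ => V (0 + t • n) - α / 2 * t ^ 2)
        (⟪gradient V (0 + t • n), n⟫ - α * t) t :=
      ((hasDerivAt_potential_line hV.smooth 0 n t).sub
        ((hasDerivAt_pow 2 t).const_mul (α / 2))).congr_deriv (by simp; ring)
    have hmono : MonotoneOn (fun t : ℝ => V (0 + t • n) - α / 2 * t ^ 2) (Set.Ici R) := by
      refine monotoneOn_of_deriv_nonneg (convex_Ici R)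
        (fun t _ => (hd t).continuousAt.continuousWithinAt)
        (fun t _ => (hd t).differentiableAt.differentiableWithinAt) fun t ht => ?_
      rw [interior_Ici, Set.mem_Ioi] at ht
      have ht0 : 0 < t := hR.trans ht
      have h2 : ‖t • n‖ = t := by rw [norm_smul, hn, mul_one, Real.norm_of_nonneg ht0.le]
      have h1 := hg (t • n) (by rw [h2]; exact ht)
      rw [h2, real_inner_smul_left, real_inner_comm] at h1
      rw [(hd t).deriv, zero_add]
      have : α * t ≤ ⟪gradient V (t • n), n⟫ := by
        refine le_of_mul_le_mul_left ?_ ht0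
        nlinarith
      linarith
    have h3 := hmono (Set.mem_Ici.2 le_rfl) (Set.mem_Ici.2 h.le) h.le
    have h4 : ‖y‖ • n = y := by simp only [n]; rw [smul_smul, mul_inv_cancel₀ hy0.ne', one_smul]
    simp only [zero_add, h4] at h3
    have h5 := hV.nonneg (R • n)
    have h6 : α / 2 * (‖y‖ ^ 2 - R ^ 2) ≤ V y := by linarith
    rw [div_mul_eq_mul_div, le_div_iff₀ hα]; linarith
  · have : R < ‖y‖ := lt_of_pow_lt_pow_left₀ 2 (norm_nonneg _) hy
    have := hg y this
    have : 0 ≤ α * ‖y‖ ^ 2 := by positivity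
    linarith

lemma exists_hessian_bound (hV : ContDiff ℝ (⊤ : ℕ∞) V) (R : ℝ) :
    ∃ Λ > (0 : ℝ), ∀ y, ‖y‖ ≤ R → ‖fderiv ℝ (gradient V) y‖ ≤ Λ := by
  have hc : Continuous (fderiv ℝ (gradient V)) := (contDiff_gradient hV).continuous_fderiv (by simp)
  obtain ⟨B, hB⟩ := (isCompact_closedBall (0 : Evec k) R).exists_bound_of_continuousOn hc.continuousOn
  refine ⟨|B| + 1, by positivity, fun y hy => ?_⟩
  have := hB y (by simpa using hy)
  linarith [le_abs_self B]

lemma exists_gradient_bound (hV : ContDiff ℝ (⊤ : ℕ∞) V) (R : ℝ) :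
    ∃ G > (0 : ℝ), ∀ y, ‖y‖ ≤ R → ‖gradient V y‖ ≤ G := by
  have hc : Continuous (gradient V) := (contDiff_gradient hV).continuous
  obtain ⟨B, hB⟩ := (isCompact_closedBall (0 : Evec k) R).exists_bound_of_continuousOn hc.continuousOn
  refine ⟨|B| + 1, by positivity, fun y hy => ?_⟩
  have := hB y (by simpa using hy)
  linarith [le_abs_self B]

lemma abs_inner_apply_le {T : Evec k →L[ℝ] Evec k} {Λ : ℝ} (hT : ‖T‖ ≤ Λ) (ξ : Evec k) :
    |⟪T ξ, ξ⟫| ≤ Λ * ‖ξ‖ ^ 2 := by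
  refine (abs_real_inner_le_norm _ _).trans ?_
  have := T.le_of_opNorm_le hT ξ
  nlinarith [norm_nonneg ξ]

/-- A nonnegative function with bounded Hessian controls the square of its gradient. -/
lemma exists_gradient_sq_le (hV : ContDiff ℝ (⊤ : ℕ∞) V) (h0 : ∀ y, 0 ≤ V y) (R : ℝ) :
    ∃ L > (0 : ℝ), ∀ y, ‖y‖ ≤ R → ‖gradient V y‖ ^ 2 ≤ L * V y := by
  obtain ⟨G, hG, hGb⟩ := exists_gradient_bound hV R
  obtain ⟨Λ, hΛ, hΛb⟩ := exists_hessian_bound hV (R + G)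
  set M := Λ + 1
  have hM : 0 < M := by positivity
  refine ⟨2 * M, by positivity, fun y hy => ?_⟩
  set g := -gradient V y
  have hgn : ‖g‖ = ‖gradient V y‖ := norm_neg _
  have hball (t : ℝ) (ht : t ∈ Set.Icc (0 : ℝ) 1) : ‖y + t • g‖ ≤ R + G := by
    refine (norm_add_le _ _).trans (add_le_add hy ?_)
    rw [norm_smul, Real.norm_of_nonneg ht.1, hgn]
    have := hGb y hy
    nlinarith [norm_nonneg (gradient V y), ht.1, ht.2]
  have hconst : ∀ t : ℝ, gradient V (y + (0 : ℝ) • g) = -g := fun _ => by simp [g]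
  have hd2 (t : ℝ) := hasDerivAt_gradient_line hV y g g t
  have hslope : AntitoneOn (fun t : ℝ => ⟪gradient V (y + t • g), g⟫ - M * ‖g‖ ^ 2 * t)
      (Set.Icc 0 1) := by
    have hd (t : ℝ) := (hd2 t).sub ((hasDerivAt_id t).const_mul (M * ‖g‖ ^ 2))
    refine antitoneOn_of_deriv_nonpos (convex_Icc 0 1)
      (fun t _ => (hd t).continuousAt.continuousWithinAt)
      (fun t _ => (hd t).differentiableAt.differentiableWithinAt) fun t ht => ?_
    have h1 := (abs_le.1 (abs_inner_apply_le (hΛb _ (hball t (interior_subset ht))) g)).2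
    refine le_of_eq_of_le (hd t).deriv ?_
    simp only [M]
    nlinarith [sq_nonneg ‖g‖]
  have hval : AntitoneOn (fun t : ℝ => V (y + t • g) + ‖g‖ ^ 2 * t - M * ‖g‖ ^ 2 / 2 * t ^ 2)
      (Set.Icc 0 1) := by
    have hd (t : ℝ) := (((hasDerivAt_potential_line hV y g t).add
      ((hasDerivAt_id t).const_mul (‖g‖ ^ 2))).sub
      ((hasDerivAt_pow 2 t).const_mul (M * ‖g‖ ^ 2 / 2)))
    refine antitoneOn_of_deriv_nonpos (convex_Icc 0 1)
      (fun t _ => (hd t).continuousAt.continuousWithinAt)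
      (fun t _ => (hd t).differentiableAt.differentiableWithinAt) fun t ht => ?_
    refine le_of_eq_of_le (hd t).deriv ?_
    have h1 := hslope (Set.left_mem_Icc.2 zero_le_one) (interior_subset ht) (interior_subset ht).1
    simp only [hconst 0, inner_neg_left, real_inner_self_eq_norm_sq, mul_zero, sub_zero] at h1
    simp only [Nat.cast_ofNat, Nat.add_one_sub_one, pow_one, mul_one]
    linarith
  have hs : M⁻¹ ∈ Set.Icc (0 : ℝ) 1 := ⟨by positivity, inv_le_one_of_one_le₀ (by simp [M, hΛ.le])⟩
  have h1 := hval (Set.left_mem_Icc.2 zero_le_one) hs hs.1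
  have h2 := h0 (y + M⁻¹ • g)
  simp only [zero_smul, add_zero, mul_zero, ne_eq, OfNat.ofNat_ne_zero, not_false_eq_true,
    zero_pow, sub_zero, hgn] at h1
  have h3 : M * ‖gradient V y‖ ^ 2 / 2 * M⁻¹ ^ 2 = ‖gradient V y‖ ^ 2 * M⁻¹ / 2 := by
    field_simp
  rw [h3] at h1
  have h4 : ‖gradient V y‖ ^ 2 * M⁻¹ ≤ 2 * V y := by linarith
  rw [← div_eq_mul_inv, div_le_iff₀ hM] at h4
  linarith

/-- Strict convexity near a nondegenerate zero. -/
lemma eventually_nhds_zero (hV : IsMultiWell V) {σ : Evec k} (hσ : V σ = 0) :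
    ∀ᶠ l in 𝓝[>] (0 : ℝ), ∀ᶠ y in 𝓝 σ, (∀ ξ, l * ‖ξ‖ ^ 2 ≤ ⟪fderiv ℝ (gradient V) y ξ, ξ⟫) ∧
      l * V y ≤ ‖gradient V y‖ ^ 2 := by
  have hs := hV.smooth
  set D := fderiv ℝ (gradient V)
  have hDc : Continuous D := (contDiff_gradient hs).continuous_fderiv (by simp)
  obtain ⟨m, hm, hmb⟩ : ∃ m > (0 : ℝ), ∀ ξ, m * ‖ξ‖ ^ 2 ≤ ⟪D σ ξ, ξ⟫ := by
    have hq : Continuous fun ξ : Evec k => ⟪D σ ξ, ξ⟫ := by fun_prop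
    have hpos : ∀ ξ ∈ sphere (0 : Evec k) 1, 0 < ⟪D σ ξ, ξ⟫ := fun ξ hξ => by
      rw [inner_fderiv_gradient hs]
      exact hV.hess_posdef σ hσ ξ (by rintro rfl; simp at hξ)
    obtain ⟨m, hm, hmb⟩ := (isCompact_sphere (0 : Evec k) 1).exists_forall_le' hq.continuousOn
      (a := 0) hpos
    refine ⟨m, hm, fun ξ => ?_⟩
    by_cases h : ξ = 0
    · simp [h]
    have h1 := hmb (‖ξ‖⁻¹ • ξ) (by simpa using norm_smul_inv_norm (𝕜 := ℝ) h)
    rw [map_smul, real_inner_smul_left, real_inner_smul_right] at h1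
    have h2 : 0 < ‖ξ‖ := norm_pos_iff.2 h
    have h3 : ‖ξ‖⁻¹ * (‖ξ‖⁻¹ * ⟪D σ ξ, ξ⟫) = ⟪D σ ξ, ξ⟫ / ‖ξ‖ ^ 2 := by field_simp
    rw [h3, le_div_iff₀ (by positivity)] at h1
    exact h1
  obtain ⟨r, hr, hrb⟩ := Metric.continuousAt_iff.1 hDc.continuousAt (m / 2) (by positivity)
  have hhess : ∀ y ∈ ball σ r, ∀ ξ, m / 2 * ‖ξ‖ ^ 2 ≤ ⟪D y ξ, ξ⟫ := by
    intro y hy ξ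
    have h1 := (hrb (mem_ball.1 hy)).le
    rw [dist_eq_norm] at h1
    have h2 := (abs_le.1 (abs_inner_apply_le h1 ξ)).1
    rw [sub_apply, inner_sub_left] at h2
    linarith [hmb ξ]
  filter_upwards [Ioo_mem_nhdsGT (show (0 : ℝ) < m / 2 by positivity)] with l hl
  filter_upwards [ball_mem_nhds σ hr] with y hy
  refine ⟨fun ξ => le_trans ?_ (hhess y hy ξ), ?_⟩
  · have := hl.2.le
    gcongr
  set η := y - σ
  have hseg (t : ℝ) (ht : t ∈ Set.Icc (0 : ℝ) 1) : σ + t • η ∈ ball σ r := by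
    simp only [mem_ball, dist_eq_norm, add_sub_cancel_left, norm_smul, Real.norm_of_nonneg ht.1]
    rw [mem_ball, dist_eq_norm] at hy
    exact lt_of_le_of_lt (mul_le_of_le_one_left (norm_nonneg _) ht.2) hy
  have hy1 : σ + (1 : ℝ) • η = y := by simp [η]
  have hmon : MonotoneOn (fun t : ℝ => ⟪gradient V (σ + t • η), η⟫ - l * ‖η‖ ^ 2 * t)
      (Set.Icc 0 1) := by
    have hd (t : ℝ) := (hasDerivAt_gradient_line hs σ η η t).sub
      ((hasDerivAt_id t).const_mul (l * ‖η‖ ^ 2))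
    refine monotoneOn_of_deriv_nonneg (convex_Icc 0 1)
      (fun t _ => (hd t).continuousAt.continuousWithinAt)
      (fun t _ => (hd t).differentiableAt.differentiableWithinAt) fun t ht => ?_
    refine le_of_le_of_eq ?_ (hd t).deriv.symm
    have h1 := hhess _ (hseg t (interior_subset ht)) η
    have h2 : l * ‖η‖ ^ 2 ≤ m / 2 * ‖η‖ ^ 2 := by
      have := hl.2.le
      gcongr
    simp only [D] at h1
    linarith
  have hI1 : (1 : ℝ) ∈ Set.Icc (0 : ℝ) 1 := Set.right_mem_Icc.2 zero_le_one
  have h1 := hmon (Set.left_mem_Icc.2 zero_le_one) hI1 zero_le_one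
  simp only [zero_smul, add_zero, gradient_eq_zero_of_zero hV.nonneg hσ, inner_zero_left,
    mul_zero, sub_zero, hy1, mul_one] at h1
  have hmon2 : AntitoneOn (fun t : ℝ => V (σ + t • η) - ⟪gradient V y, η⟫ * t)
      (Set.Icc 0 1) := by
    have hd (t : ℝ) := (hasDerivAt_potential_line hs σ η t).sub
      ((hasDerivAt_id t).const_mul ⟪gradient V y, η⟫)
    refine antitoneOn_of_deriv_nonpos (convex_Icc 0 1)
      (fun t _ => (hd t).continuousAt.continuousWithinAt)
      (fun t _ => (hd t).differentiableAt.differentiableWithinAt) fun t ht => ?_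
    refine le_of_eq_of_le (hd t).deriv ?_
    have h2 := hmon (interior_subset ht) hI1 (interior_subset ht).2
    simp only [hy1, mul_one] at h2 ⊢
    have h3 : l * ‖η‖ ^ 2 * t ≤ l * ‖η‖ ^ 2 :=
      mul_le_of_le_one_right (mul_nonneg hl.1.le (sq_nonneg _)) (interior_subset ht).2
    linarith
  have h2 := hmon2 (Set.left_mem_Icc.2 zero_le_one) hI1 zero_le_one
  simp only [zero_smul, add_zero, hσ, mul_zero, sub_zero, hy1, mul_one] at h2
  have h3 := real_inner_le_norm (gradient V y) η
  have h4 : l * ‖η‖ ^ 2 ≤ ‖gradient V y‖ * ‖η‖ := by linarith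
  have h5 : l * ‖η‖ ≤ ‖gradient V y‖ := by
    rcases (norm_nonneg η).eq_or_lt with h | h
    · rw [← h, mul_zero]; exact norm_nonneg _
    · refine le_of_mul_le_mul_right ?_ h
      linarith
  have h6 : V y ≤ ‖gradient V y‖ * ‖η‖ := by linarith
  have h7 := mul_le_mul_of_nonneg_left h5 (norm_nonneg (gradient V y))
  have h8 := mul_le_mul_of_nonneg_left h6 hl.1.le
  nlinarith

lemma sq_norm_le_sSup (hV : IsMultiWell V) {σ : Evec k} (hσ : V σ = 0) :
    ‖σ‖ ^ 2 ≤ sSup ((fun σ : Evec k => ‖σ‖ ^ 2) '' {y : Evec k | V y = 0}) :=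
  le_csSup (hV.finite_zeros.image _).bddAbove ⟨σ, hσ, rfl⟩

lemma sSup_pos (hV : IsMultiWell V) :
    0 < sSup ((fun σ : Evec k => ‖σ‖ ^ 2) '' {y : Evec k | V y = 0}) := by
  obtain ⟨σ, hσ, hσ0⟩ : ∃ σ, V σ = 0 ∧ σ ≠ 0 := by
    obtain ⟨σ, hσ, h⟩ := Set.exists_ne_of_one_lt_ncard (a := (0 : Evec k)) hV.two_le_card
    exact ⟨σ, hσ, h⟩
  exact lt_of_lt_of_le (by positivity) (sq_norm_le_sSup hV hσ)

/-- Uniform nondegeneracy of the potential on a sublevel set. -/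
lemma exists_well_constants (hV : IsMultiWell V) : ∃ l > (0 : ℝ), ∃ τ > (0 : ℝ), ∀ y, V y ≤ τ →
    (∀ ξ, l * ‖ξ‖ ^ 2 ≤ ⟪fderiv ℝ (gradient V) y ξ, ξ⟫) ∧ l * V y ≤ ‖gradient V y‖ ^ 2 ∧
    ‖y‖ ^ 2 ≤ 2 * sSup ((fun σ : Evec k => ‖σ‖ ^ 2) '' {y : Evec k | V y = 0}) := by
  set S := sSup ((fun σ : Evec k => ‖σ‖ ^ 2) '' {y : Evec k | V y = 0})
  have h1 := hV.finite_zeros.eventually_all.2 fun σ hσ => eventually_nhds_zero hV hσ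
  obtain ⟨l, hl, hl0⟩ := (h1.and self_mem_nhdsWithin).exists
  set N := {y | ((∀ ξ, l * ‖ξ‖ ^ 2 ≤ ⟪fderiv ℝ (gradient V) y ξ, ξ⟫) ∧
    l * V y ≤ ‖gradient V y‖ ^ 2) ∧ ‖y‖ ^ 2 ≤ 2 * S}
  have hN : ∀ σ, V σ = 0 → N ∈ 𝓝 σ := by
    intro σ hσ
    have h2 : ∀ᶠ y in 𝓝 σ, ‖y‖ ^ 2 < 2 * S := by
      have hc : Continuous fun y : Evec k => ‖y‖ ^ 2 := by fun_prop
      refine hc.continuousAt.eventually_lt_const ?_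
      have := sq_norm_le_sSup hV hσ
      have := sSup_pos hV
      simp only [S]; linarith
    filter_upwards [hl σ hσ, h2] with y hy hy2 using ⟨hy, hy2.le⟩
  obtain ⟨R, hR⟩ := hV.coercive 1
  have hK : IsCompact (closedBall (0 : Evec k) R \ interior N) :=
    (isCompact_closedBall _ _).diff isOpen_interior
  obtain ⟨m, hm, hmb⟩ := hK.exists_forall_le' hV.smooth.continuous.continuousOn (a := 0)
    (fun y hy => lt_of_le_of_ne (hV.nonneg y) fun h =>
      hy.2 (mem_interior_iff_mem_nhds.2 (hN y h.symm)))
  refine ⟨l, hl0, min (m / 2) (1 / 2), by positivity, fun y hy => ?_⟩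
  have hyN : y ∈ N := by
    by_contra hn
    rcases le_or_gt R ‖y‖ with h | h
    · have := hR y h
      have := hy.trans (min_le_right _ _)
      linarith
    · have := hmb y ⟨by simpa using h.le, fun h' => hn (interior_subset h')⟩
      have := hy.trans (min_le_left _ _)
      linarith
  exact ⟨hyN.1.1, hyN.1.2, hyN.2⟩

end Potential

end AllenCahn

namespace AllenCahn

/-- Integrated form of a differential inequality `f ≤ Δw + h`. -/
lemma cutoff_estimate : ∃ C > (0 : ℝ), ∀ r > (0 : ℝ), ∀ w f h : ℝ × ℝ → ℝ,
    ContDiff ℝ (⊤ : ℕ∞) w → IntegrableOn f (Sq r) → IntegrableOn h (Sq r) →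
    (∀ p ∈ Sq r, 0 ≤ f p) → (∀ p ∈ Sq r, 0 ≤ h p) → (∀ p ∈ Sq r, 0 ≤ w p) →
    (∀ p ∈ Sq r, f p ≤ lapl w p + h p) →
    ∫ p in Sq (3 / 4 * r), f p ≤ C / r ^ 2 * (∫ p in Sq r, w p) + ∫ p in Sq r, h p := by
  obtain ⟨C, hC, hcut⟩ := exists_cutoff
  refine ⟨C, hC, fun r hr w f h hw hf hh hf0 hh0 hw0 hle => ?_⟩
  obtain ⟨ψ, hψ, hψ0, hψ1, hψe, hψoff, hψl⟩ := hcut r hr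
  have hsub : Sq (3 / 4 * r) ⊆ Sq r := Sq_mono (by linarith)
  have hms := measurableSet_Sq r
  have hK := isCompact_Sq r
  have h_int {g : ℝ × ℝ → ℝ} (hg : Continuous g) : IntegrableOn g (Sq r) :=
    hg.continuousOn.integrableOn_compact hK
  have hlw := (contDiff_lapl hw).continuous
  have hlψ := (contDiff_lapl hψ).continuous
  have hψh : IntegrableOn (fun p => ψ p * h p) (Sq r) :=
    hh.continuousOn_mul hψ.continuous.continuousOn hK
  have hψf : IntegrableOn (fun p => ψ p * f p) (Sq r) :=
    hf.continuousOn_mul hψ.continuous.continuousOn hK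
  have hlψoff : ∀ p, p ∉ Sq r → lapl ψ p = 0 := fun p hp => by
    simp only [lapl]
    rw [dd_eq_zero_of_notMem (dd_eq_zero_of_notMem hψoff _) _ p hp,
      dd_eq_zero_of_notMem (dd_eq_zero_of_notMem hψoff _) _ p hp, add_zero]
  calc ∫ p in Sq (3 / 4 * r), f p = ∫ p in Sq (3 / 4 * r), ψ p * f p :=
        setIntegral_congr_fun (measurableSet_Sq _) fun p hp => by simp only [hψe p hp, one_mul]
    _ ≤ ∫ p in Sq r, ψ p * f p := by
        refine setIntegral_mono_set hψf ?_ (Eventually.of_forall hsub)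
        exact (ae_restrict_iff' hms).2 (Eventually.of_forall fun p hp =>
          mul_nonneg (hψ0 p) (hf0 p hp))
    _ ≤ ∫ p in Sq r, (ψ p * lapl w p + h p) := by
        refine setIntegral_mono_on hψf ((h_int (hψ.continuous.mul hlw)).add hh) hms fun p hp => ?_
        have h1 := mul_le_mul_of_nonneg_left (hle p hp) (hψ0 p)
        have h2 := mul_le_mul_of_nonneg_right (hψ1 p) (hh0 p hp)
        linarith
    _ = (∫ p in Sq r, ψ p * lapl w p) + ∫ p in Sq r, h p :=
        integral_add (h_int (hψ.continuous.mul hlw)) hh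
    _ = (∫ p in Sq r, lapl ψ p * w p) + ∫ p in Sq r, h p := by
        rw [setIntegral_eq_integral_of_forall_compl_eq_zero (s := Sq r)
            (f := fun p => ψ p * lapl w p) fun p hp => by rw [hψoff p hp, zero_mul],
          setIntegral_eq_integral_of_forall_compl_eq_zero (s := Sq r)
            (f := fun p => lapl ψ p * w p) fun p hp => by rw [hlψoff p hp, zero_mul],
          integral_mul_lapl hψ hw hψoff]
    _ ≤ (∫ p in Sq r, C / r ^ 2 * w p) + ∫ p in Sq r, h p := by
        refine add_le_add_left (setIntegral_mono_on (h_int (hlψ.mul hw.continuous))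
          (h_int (continuous_const.mul hw.continuous)) hms fun p hp => ?_) _
        exact mul_le_mul_of_nonneg_right ((le_abs_self _).trans (hψl p)) (hw0 p hp)
    _ = _ := by rw [integral_const_mul]

/-- A concave truncation of the identity. -/
lemma exists_truncation {τ b : ℝ} (hτ : 0 < τ) (hb0 : 0 < b) (hb : b ≤ 1 / 2) :
    ∃ g g₁ : ℝ → ℝ, (∀ t, 0 ≤ t → ContDiffAt ℝ (⊤ : ℕ∞) g t) ∧
      (∀ t, 0 ≤ t → ContDiffAt ℝ (⊤ : ℕ∞) g₁ t) ∧
      (∀ t, 0 ≤ t → HasDerivAt g (g₁ t) t) ∧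
      (∀ t, 0 ≤ t → HasDerivAt g₁ (-(b * g₁ t / (τ + t))) t) ∧
      (∀ t, 0 ≤ t → 0 ≤ g t) ∧ (∀ t, 0 ≤ t → g t ≤ t) ∧ (∀ t, 0 ≤ t → 0 ≤ g₁ t) ∧
      (∀ t, 0 ≤ t → t ≤ τ → 1 / 2 ≤ g₁ t) ∧
      ∀ s t, 0 < s → s ≤ t → g₁ t ≤ (τ / s) ^ b := by
  set c := τ ^ b
  have hc : 0 < c := Real.rpow_pos_of_pos hτ b
  have hb1 : 0 < 1 - b := by linarith
  set g : ℝ → ℝ := fun t => c / (1 - b) * ((τ + t) ^ (1 - b) - τ ^ (1 - b))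
  set g₁ : ℝ → ℝ := fun t => c * (τ + t) ^ (-b)
  have hadd (t : ℝ) : HasDerivAt (fun t => τ + t) 1 t := (hasDerivAt_id t).const_add τ
  have hg : ∀ t, 0 ≤ t → HasDerivAt g (g₁ t) t := fun t ht => by
    have := (((hadd t).rpow_const (p := 1 - b) (Or.inl (by positivity))).sub_const
      (τ ^ (1 - b))).const_mul (c / (1 - b))
    refine this.congr_deriv ?_
    rw [show 1 - b - 1 = -b by ring]
    simp only [g₁]; field_simp
  have hg1 : ∀ t, 0 ≤ t → g₁ t = (τ / (τ + t)) ^ b := fun t ht => by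
    simp only [g₁, c]
    rw [Real.rpow_neg (by positivity), Real.div_rpow hτ.le (by positivity), div_eq_mul_inv]
  have hg1pos : ∀ t, 0 ≤ t → 0 ≤ g₁ t := fun t ht => by
    simp only [g₁]
    positivity
  have hg1le : ∀ t, 0 ≤ t → g₁ t ≤ 1 := fun t ht => by
    rw [hg1 t ht]
    exact Real.rpow_le_one (by positivity) ((div_le_one (by positivity)).2 (by linarith)) hb0.le
  have hg0 : g 0 = 0 := by simp [g]
  have hcd (q : ℝ) (t : ℝ) (ht : 0 ≤ t) :
      ContDiffAt ℝ (⊤ : ℕ∞) (fun t : ℝ => (τ + t) ^ q) t :=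
    (contDiffAt_const.add contDiffAt_id).rpow_const_of_ne (by simp only [id]; positivity)
  refine ⟨g, g₁, fun t ht => ?_, fun t ht => ?_, hg, fun t ht => ?_, fun t ht => ?_, fun t ht => ?_,
    hg1pos, fun t ht htτ => ?_, fun s t hs hst => ?_⟩
  · exact contDiffAt_const.mul ((hcd (1 - b) t ht).sub contDiffAt_const)
  · exact contDiffAt_const.mul (hcd (-b) t ht)
  · have := ((hadd t).rpow_const (p := -b) (Or.inl (by positivity))).const_mul c
    refine this.congr_deriv ?_
    simp only [g₁]
    rw [Real.rpow_sub_one (by positivity)]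
    field_simp
  · have : τ ^ (1 - b) ≤ (τ + t) ^ (1 - b) :=
      Real.rpow_le_rpow hτ.le (by linarith) hb1.le
    exact mul_nonneg (by positivity) (by linarith)
  · have hmono : MonotoneOn (fun t => t - g t) (Set.Ici 0) := by
      have hd (t : ℝ) (ht : 0 ≤ t) := (hasDerivAt_id t).sub (hg t ht)
      refine monotoneOn_of_deriv_nonneg (convex_Ici 0)
        (fun t ht => (hd t ht).continuousAt.continuousWithinAt)
        (fun t ht => (hd t (interior_subset ht)).differentiableAt.differentiableWithinAt)
        fun t ht => ?_
      refine le_of_le_of_eq ?_ (hd t (interior_subset ht)).deriv.symm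
      linarith [hg1le t (interior_subset ht)]
    have := hmono (Set.mem_Ici.2 le_rfl) (Set.mem_Ici.2 ht) ht
    simp only [hg0, sub_zero] at this
    linarith
  · rw [hg1 t ht]
    have h1 : (1 : ℝ) / 2 ≤ τ / (τ + t) := by
      rw [div_le_div_iff₀ (by norm_num) (by positivity)]; linarith
    calc (1 : ℝ) / 2 = (1 / 2) ^ (1 : ℝ) := (Real.rpow_one _).symm
      _ ≤ (1 / 2) ^ b := Real.rpow_le_rpow_of_exponent_ge (by norm_num) (by norm_num) (by linarith)
      _ ≤ _ := Real.rpow_le_rpow (by norm_num) h1 hb0.le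
  · have ht : 0 < t := hs.trans_le hst
    rw [hg1 t ht.le]
    refine Real.rpow_le_rpow (by positivity) ?_ hb0.le
    gcongr
    linarith

section Solutions

variable {k : ℕ} {V : Evec k → ℝ} {U : ℝ × ℝ → Evec k}

/-- The energy density of `U` at scale `ε = 1`. -/
def en (V : Evec k → ℝ) (U : ℝ × ℝ → Evec k) (p : ℝ × ℝ) : ℝ :=
  (‖dd e₁ U p‖ ^ 2 + ‖dd e₂ U p‖ ^ 2) / 2 + V (U p)

lemma continuous_en (hV : ContDiff ℝ (⊤ : ℕ∞) V) (hU : ContDiff ℝ (⊤ : ℕ∞) U) :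
    Continuous (en V U) := by
  have h1 := continuous_dd (contDiff_one_of_smooth hU) e₁
  have h2 := continuous_dd (contDiff_one_of_smooth hU) e₂
  have h3 := hV.continuous.comp hU.continuous
  exact (((h1.norm.pow 2).add (h2.norm.pow 2)).div_const 2).add h3

lemma en_nonneg (h0 : ∀ y, 0 ≤ V y) (p : ℝ × ℝ) : 0 ≤ en V U p := by
  have := h0 (U p)
  simp only [en]; positivity

lemma potential_le_en (p : ℝ × ℝ) : V (U p) ≤ en V U p := by
  simp only [en, le_add_iff_nonneg_left]; positivity

lemma integrableOn_Sq {f : ℝ × ℝ → ℝ} (hf : Continuous f) (r : ℝ) : IntegrableOn f (Sq r) :=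
  hf.continuousOn.integrableOn_compact (isCompact_Sq r)

lemma dd_potential (hV : ContDiff ℝ (⊤ : ℕ∞) V) (hU : ContDiff ℝ (⊤ : ℕ∞) U) (w p : ℝ × ℝ) :
    dd w (fun q => V (U q)) p = ⟪gradient V (U p), dd w U p⟫ := by
  rw [dd_comp (hV.differentiable (by simp)) (differentiable_of_smooth hU), inner_gradient_left]

lemma lapl_potential (hV : ContDiff ℝ (⊤ : ℕ∞) V) (hU : ContDiff ℝ (⊤ : ℕ∞) U) (p : ℝ × ℝ) :
    lapl (fun q => V (U q)) p =
      ⟪fderiv ℝ (gradient V) (U p) (dd e₁ U p), dd e₁ U p⟫ +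
      ⟪fderiv ℝ (gradient V) (U p) (dd e₂ U p), dd e₂ U p⟫ + ⟪gradient V (U p), lapl U p⟫ := by
  have hgU : Differentiable ℝ fun q => gradient V (U q) :=
    (differentiable_gradient hV).comp (differentiable_of_smooth hU)
  have key (w : ℝ × ℝ) : dd w (dd w fun q => V (U q)) p =
      ⟪gradient V (U p), dd w (dd w U) p⟫ +
        ⟪fderiv ℝ (gradient V) (U p) (dd w U p), dd w U p⟫ := by
    have h1 : (dd w fun q => V (U q)) = fun q => ⟪gradient V (U q), dd w U q⟫ :=
      funext (dd_potential hV hU w)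
    rw [h1, dd_inner hgU (differentiable_of_smooth (contDiff_dd hU w)),
      dd_comp (differentiable_gradient hV) (differentiable_of_smooth hU)]
  simp only [lapl, key, inner_add_right]
  ring

/-- Bounds for the derivatives of the potential on a ball and on a sublevel set. -/
structure PotentialBounds (V : Evec k → ℝ) (ρ l Λ L τ₀ : ℝ) : Prop where
  smooth : ContDiff ℝ (⊤ : ℕ∞) V
  nonneg : ∀ y, 0 ≤ V y
  l_pos : 0 < l
  Λ_pos : 0 < Λ
  L_pos : 0 < L
  τ₀_pos : 0 < τ₀
  hess_le : ∀ y, ‖y‖ ≤ ρ → ‖fderiv ℝ (gradient V) y‖ ≤ Λ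
  grad_le : ∀ y, ‖y‖ ≤ ρ → ‖gradient V y‖ ^ 2 ≤ L * V y
  le_hess : ∀ y, V y ≤ τ₀ → ∀ ξ, l * ‖ξ‖ ^ 2 ≤ ⟪fderiv ℝ (gradient V) y ξ, ξ⟫
  le_grad : ∀ y, V y ≤ τ₀ → l * V y ≤ ‖gradient V y‖ ^ 2

/-- `U` is a smooth solution on the square of half-side `R`, bounded by `ρ` there. -/
structure BoundedSolution (V : Evec k → ℝ) (U : ℝ × ℝ → Evec k) (R ρ : ℝ) : Prop where
  smooth : ContDiff ℝ (⊤ : ℕ∞) U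
  eq : ∀ p ∈ Sq R, lapl U p = gradient V (U p)
  bound : ∀ p ∈ Sq R, ‖U p‖ ≤ ρ

variable {ρ l Λ L τ₀ R : ℝ}

lemma lapl_potential_lower (hP : PotentialBounds V ρ l Λ L τ₀) (hU : BoundedSolution V U R ρ)
    {p : ℝ × ℝ} (hp : p ∈ Sq R) :
    -Λ * (‖dd e₁ U p‖ ^ 2 + ‖dd e₂ U p‖ ^ 2) ≤ lapl (fun q => V (U q)) p := by
  rw [lapl_potential hP.smooth hU.smooth, hU.eq p hp, real_inner_self_eq_norm_sq]
  have h1 := (abs_le.1 (abs_inner_apply_le (hP.hess_le _ (hU.bound p hp)) (dd e₁ U p))).1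
  have h2 := (abs_le.1 (abs_inner_apply_le (hP.hess_le _ (hU.bound p hp)) (dd e₂ U p))).1
  linarith [sq_nonneg ‖gradient V (U p)‖]

lemma lapl_potential_lower_well (hP : PotentialBounds V ρ l Λ L τ₀)
    (hU : BoundedSolution V U R ρ) {p : ℝ × ℝ} (hp : p ∈ Sq R) (hv : V (U p) ≤ τ₀) :
    l * (‖dd e₁ U p‖ ^ 2 + ‖dd e₂ U p‖ ^ 2) + ‖gradient V (U p)‖ ^ 2 ≤
      lapl (fun q => V (U q)) p := by
  rw [lapl_potential hP.smooth hU.smooth, hU.eq p hp, real_inner_self_eq_norm_sq]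
  have h1 := hP.le_hess _ hv (dd e₁ U p)
  have h2 := hP.le_hess _ hv (dd e₂ U p)
  linarith

/-- The energy in the region close to the wells is small compared to the total energy. -/
lemma exists_energy_low (hP : PotentialBounds V ρ l Λ L τ₀) :
    ∃ C > (0 : ℝ), ∃ b > (0 : ℝ), ∀ τ > (0 : ℝ), τ ≤ τ₀ → ∀ R > (0 : ℝ), ∀ U : ℝ × ℝ → Evec k,
      BoundedSolution V U R ρ →
      ∫ p in Sq (3 / 4 * R), {q | V (U q) ≤ τ}.indicator (en V U) p ≤
        C * (1 / R ^ 2 + (τ / τ₀) ^ b) * ∫ p in Sq R, en V U p := by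
  obtain ⟨C₀, hC₀, hcut⟩ := cutoff_estimate
  have hl := hP.l_pos
  have hΛ := hP.Λ_pos
  have hL := hP.L_pos
  have hτ₀ := hP.τ₀_pos
  set b := min (1 / 2) (l / (2 * L))
  have hb : 0 < b := by positivity
  have hbL : b * L ≤ l / 2 := by
    calc b * L ≤ l / (2 * L) * L := by gcongr; exact min_le_right _ _
      _ = l / 2 := by field_simp
  set C := 2 / l * (C₀ + (2 * Λ + l))
  refine ⟨C, by positivity, b, hb, fun τ hτ hττ R hR U hU => ?_⟩
  obtain ⟨g, g₁, hgc, hg1c, hgd, hg1d, hg0, hgle, hg1nn, hg1half, hg1s⟩ :=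
    exists_truncation hτ hb (min_le_left _ _)
  have hv : ContDiff ℝ (⊤ : ℕ∞) fun p => V (U p) := hP.smooth.comp hU.smooth
  have hv0 (p : ℝ × ℝ) : 0 ≤ V (U p) := hP.nonneg _
  set δ := (τ / τ₀) ^ b
  have hδ : 0 < δ := by positivity
  have hen := continuous_en hP.smooth hU.smooth
  set w : ℝ × ℝ → ℝ := fun p => g (V (U p))
  have hw : ContDiff ℝ (⊤ : ℕ∞) w := contDiff_iff_contDiffAt.2 fun p =>
    (hgc _ (hv0 p)).comp p hv.contDiffAt
  have hw1 : ContDiff ℝ (⊤ : ℕ∞) fun p => g₁ (V (U p)) := contDiff_iff_contDiffAt.2 fun p =>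
    (hg1c _ (hv0 p)).comp p hv.contDiffAt
  have hlw (p : ℝ × ℝ) := lapl_comp_real hv (g := g) (g' := g₁)
    (g'' := fun t => -(b * g₁ t / (τ + t))) (fun p => hgd _ (hv0 p)) (fun p => hg1d _ (hv0 p))
    (differentiable_of_smooth hw1) p
  have hpt : ∀ p ∈ Sq R, l / 2 * {q | V (U q) ≤ τ}.indicator (en V U) p ≤
      lapl w p + δ * (2 * Λ + l) * en V U p := by
    intro p hp
    have he0 : 0 ≤ en V U p := en_nonneg hP.nonneg p
    set Q := ‖dd e₁ U p‖ ^ 2 + ‖dd e₂ U p‖ ^ 2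
    set v := V (U p)
    set G := ‖gradient V (U p)‖ ^ 2
    have hQ : 0 ≤ Q := by positivity
    have hv0' : 0 ≤ v := hv0 p
    have heq : en V U p = Q / 2 + v := rfl
    have hg1p := hg1nn v hv0'
    have hgrad : (dd e₁ (fun q => V (U q)) p) ^ 2 + (dd e₂ (fun q => V (U q)) p) ^ 2 ≤ G * Q := by
      rw [dd_potential hP.smooth hU.smooth, dd_potential hP.smooth hU.smooth]
      have key (ξ : Evec k) : ⟪gradient V (U p), ξ⟫ ^ 2 ≤ G * ‖ξ‖ ^ 2 := by
        rw [← mul_pow, ← sq_abs]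
        exact pow_le_pow_left₀ (abs_nonneg _) (abs_real_inner_le_norm _ _) 2
      have h1 := key (dd e₁ U p)
      have h2 := key (dd e₂ U p)
      simp only [Q]; linarith
    have hG : G ≤ L * v := hP.grad_le _ (hU.bound p hp)
    have hterm : g₁ v * (-(l / 2) * Q) ≤ -(b * g₁ v / (τ + v)) *
        ((dd e₁ (fun q => V (U q)) p) ^ 2 + (dd e₂ (fun q => V (U q)) p) ^ 2) := by
      set D := (dd e₁ (fun q => V (U q)) p) ^ 2 + (dd e₂ (fun q => V (U q)) p) ^ 2
      have h1 : D ≤ L * (τ + v) * Q := hgrad.trans (by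
        apply mul_le_mul_of_nonneg_right _ hQ
        nlinarith)
      have h2 : b * D / (τ + v) ≤ l / 2 * Q := by
        rw [div_le_iff₀ (by positivity)]
        calc b * D ≤ b * (L * (τ + v) * Q) := by gcongr
          _ = b * L * ((τ + v) * Q) := by ring
          _ ≤ l / 2 * ((τ + v) * Q) := by gcongr
          _ = _ := by ring
      have h3 := mul_le_mul_of_nonneg_left h2 hg1p
      calc g₁ v * (-(l / 2) * Q) = -(g₁ v * (l / 2 * Q)) := by ring
        _ ≤ -(g₁ v * (b * D / (τ + v))) := by linarith
        _ = _ := by ring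
    rw [hlw p]
    rcases le_or_gt v τ₀ with hvτ | hvτ
    · have h1 := lapl_potential_lower_well hP hU hp hvτ
      have h2 := mul_le_mul_of_nonneg_left h1 hg1p
      have h3 : l * v ≤ G := hP.le_grad _ hvτ
      have h4 := mul_le_mul_of_nonneg_left h3 hg1p
      have h5 : g₁ v * (l * en V U p) ≤ g₁ v * lapl (fun q => V (U q)) p + -(b * g₁ v / (τ + v)) *
          ((dd e₁ (fun q => V (U q)) p) ^ 2 + (dd e₂ (fun q => V (U q)) p) ^ 2) := by
        rw [heq]; linarith
      have h6 : 0 ≤ δ * (2 * Λ + l) * en V U p := by positivity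
      refine le_trans ?_ (le_trans h5 (le_add_of_nonneg_right h6))
      have h7 : 0 ≤ l * en V U p := by positivity
      by_cases hτv : v ≤ τ
      · rw [Set.indicator_of_mem (show p ∈ {q | V (U q) ≤ τ} from hτv)]
        have := mul_le_mul_of_nonneg_right (hg1half v hv0' hτv) h7
        linarith
      · rw [Set.indicator_of_notMem (show p ∉ {q | V (U q) ≤ τ} from hτv), mul_zero]
        positivity
    · have h1 := lapl_potential_lower hP hU hp
      have h2 := mul_le_mul_of_nonneg_left h1 hg1p
      rw [Set.indicator_of_notMem (show p ∉ {q | V (U q) ≤ τ} from not_le.2 (lt_of_le_of_lt hττ hvτ)),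
        mul_zero]
      have h3 : g₁ v ≤ δ := hg1s τ₀ v hτ₀ hvτ.le
      have h4 : g₁ v * ((Λ + l / 2) * Q) ≤ δ * ((2 * Λ + l) * en V U p) := by
        have : (Λ + l / 2) * Q ≤ (2 * Λ + l) * en V U p := by
          rw [heq]
          have : 0 ≤ (2 * Λ + l) * v := by positivity
          linarith
        have h5 : 0 ≤ (Λ + l / 2) * Q := by positivity
        exact mul_le_mul h3 this h5 hδ.le
      linarith
  have hms : MeasurableSet {q | V (U q) ≤ τ} := measurableSet_le hv.continuous.measurable
    measurable_const
  have h1 := hcut R hR w (fun p => l / 2 * {q | V (U q) ≤ τ}.indicator (en V U) p)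
    (fun p => δ * (2 * Λ + l) * en V U p) hw
    (((integrableOn_Sq hen R).indicator hms).const_mul _)
    ((integrableOn_Sq hen R).const_mul _)
    (fun p _ => mul_nonneg (by positivity) (Set.indicator_nonneg (fun q _ => en_nonneg hP.nonneg q) p))
    (fun p _ => mul_nonneg (by positivity) (en_nonneg hP.nonneg p))
    (fun p _ => hg0 _ (hv0 p)) hpt
  rw [integral_const_mul, integral_const_mul] at h1
  have h2 : ∫ p in Sq R, w p ≤ ∫ p in Sq R, en V U p :=
    setIntegral_mono_on (integrableOn_Sq hw.continuous R) (integrableOn_Sq hen R)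
      (measurableSet_Sq R) fun p _ => (hgle _ (hv0 p)).trans (potential_le_en p)
  set I := ∫ p in Sq R, en V U p
  have hI : 0 ≤ I := integral_nonneg fun p => en_nonneg hP.nonneg p
  set J := ∫ p in Sq (3 / 4 * R), {q | V (U q) ≤ τ}.indicator (en V U) p
  have h3 : l / 2 * J ≤ C₀ / R ^ 2 * I + δ * (2 * Λ + l) * I := by
    refine h1.trans (add_le_add_left ?_ _)
    gcongr
  have h4 : C₀ / R ^ 2 * I + δ * (2 * Λ + l) * I ≤ (C₀ + (2 * Λ + l)) * (1 / R ^ 2 + δ) * I := by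
    rw [← add_mul]
    refine mul_le_mul_of_nonneg_right ?_ hI
    have : 0 ≤ (2 * Λ + l) * (1 / R ^ 2) := by positivity
    have : 0 ≤ C₀ * δ := by positivity
    rw [div_eq_mul_one_div C₀]
    linarith
  calc J = 2 / l * (l / 2 * J) := by field_simp
    _ ≤ 2 / l * ((C₀ + (2 * Λ + l)) * (1 / R ^ 2 + δ) * I) := by
        have := h3.trans h4
        gcongr
    _ = _ := by simp only [C]; ring

/-- The energy is controlled by the potential on a larger square. -/
lemma exists_energy_le_potential (hP : PotentialBounds V ρ l Λ L τ₀) (L₀ : ℝ) :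
    ∃ C > (0 : ℝ), ∀ R ≥ (1 : ℝ), ∀ U : ℝ × ℝ → Evec k, BoundedSolution V U R ρ →
      (∀ p ∈ Sq R, ‖dd e₁ U p‖ ≤ L₀) → (∀ p ∈ Sq R, ‖dd e₂ U p‖ ≤ L₀) →
      ∫ p in Sq (3 / 4 * R), en V U p ≤ C * ∫ p in Sq R, V (U p) := by
  obtain ⟨C₀, hC₀, hcut⟩ := cutoff_estimate
  have hl := hP.l_pos
  have hΛ := hP.Λ_pos
  have hτ₀ := hP.τ₀_pos
  set C₁ := (l + 2 * Λ) * L₀ ^ 2 / τ₀ + l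
  refine ⟨1 / l * (C₀ + C₁), by positivity, fun R hR U hU h1 h2 => ?_⟩
  have hv : ContDiff ℝ (⊤ : ℕ∞) fun p => V (U p) := hP.smooth.comp hU.smooth
  have hen := continuous_en hP.smooth hU.smooth
  have hpt : ∀ p ∈ Sq R, l * en V U p ≤ lapl (fun q => V (U q)) p + C₁ * V (U p) := by
    intro p hp
    have hv0 : 0 ≤ V (U p) := hP.nonneg _
    have hX : 0 ≤ (l + 2 * Λ) * L₀ ^ 2 / τ₀ := by positivity
    rcases le_or_gt (V (U p)) τ₀ with hvτ | hvτ
    · have h3 := lapl_potential_lower_well hP hU hp hvτ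
      have h4 := hP.le_grad _ hvτ
      have h5 : 0 ≤ C₁ * V (U p) := by positivity
      have h6 : 0 ≤ l * (‖dd e₁ U p‖ ^ 2 + ‖dd e₂ U p‖ ^ 2) := by positivity
      simp only [en]; linarith
    · have h3 := lapl_potential_lower hP hU hp
      have h4 : ‖dd e₁ U p‖ ^ 2 + ‖dd e₂ U p‖ ^ 2 ≤ 2 * L₀ ^ 2 := by
        have := pow_le_pow_left₀ (norm_nonneg _) (h1 p hp) 2
        have := pow_le_pow_left₀ (norm_nonneg _) (h2 p hp) 2
        linarith
      have h5 : (l / 2 + Λ) * (‖dd e₁ U p‖ ^ 2 + ‖dd e₂ U p‖ ^ 2) ≤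
          (l + 2 * Λ) * L₀ ^ 2 / τ₀ * V (U p) := by
        calc _ ≤ (l / 2 + Λ) * (2 * L₀ ^ 2) := by gcongr
          _ = (l + 2 * Λ) * L₀ ^ 2 / τ₀ * τ₀ := by field_simp
          _ ≤ _ := by gcongr
      simp only [en, C₁]
      linarith
  have h3 := hcut R (by linarith) _ (fun p => l * en V U p) (fun p => C₁ * V (U p)) hv
    ((integrableOn_Sq hen R).const_mul _) ((integrableOn_Sq hv.continuous R).const_mul _)
    (fun p _ => mul_nonneg hl.le (en_nonneg hP.nonneg p))
    (fun p _ => mul_nonneg (by positivity) (hP.nonneg _)) (fun p _ => hP.nonneg _) hpt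
  rw [integral_const_mul, integral_const_mul] at h3
  have hI : 0 ≤ ∫ p in Sq R, V (U p) := integral_nonneg fun p => hP.nonneg _
  have h4 : C₀ / R ^ 2 ≤ C₀ := div_le_self hC₀.le (one_le_pow₀ hR)
  have h5 := mul_le_mul_of_nonneg_right h4 hI
  rw [one_div, mul_assoc, ← div_eq_inv_mul, le_div_iff₀ hl]
  linarith

end Solutions

end AllenCahn

namespace AllenCahn

/-- A cutoff in one variable whose derivative lives where a given function is small. -/
lemma exists_line_cutoff {R θ m : ℝ} (hR : 0 < R) (hθ : 0 < θ) {f : ℝ → ℝ} (hf : Continuous f)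
    (hf0 : ∀ s, 0 ≤ f s) (hm : ∫ s in (-R)..R, f s ≤ m) (hmR : m ≤ R / 12 * θ) :
    ∃ φ φ' : ℝ → ℝ, (∀ s, HasDerivAt φ (φ' s) s) ∧ Continuous φ' ∧ (∀ s, 0 ≤ φ s) ∧
      (∀ s, φ s ≤ 1) ∧ (∀ s, |s| ≤ R / 2 → φ s = 1) ∧ (∀ s, 3 / 4 * R < |s| → φ s = 0) ∧
      (∀ s, |φ' s| ≤ 24 / R) ∧ ∀ s, φ' s ≠ 0 → |s| ≤ 3 / 4 * R ∧ f s ≤ θ := by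
  set a := R / 2
  set b := 3 / 4 * R
  have hab : a < b := by simp only [a, b]; linarith
  have hbR : b < R := by simp only [b]; linarith
  have ha : 0 < a := by positivity
  set P : ℝ → ℝ := fun t => 64 / R ^ 2 * ((t - a) * (b - t))
  have hP : Continuous P := by fun_prop
  set β : ℝ → ℝ := fun t => max 0 (P t)
  have hP1 : ∀ t, P t ≤ 1 := fun t => by
    simp only [P]
    rw [div_mul_eq_mul_div, div_le_one (by positivity)]
    simp only [a, b]
    nlinarith [sq_nonneg (2 * t - 5 / 4 * R)]
  have hβ1 : ∀ t, β t ≤ 1 := fun t => max_le zero_le_one (hP1 t)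
  have hβ0 : ∀ t, 0 ≤ β t := fun t => le_max_left _ _
  have hPoff : ∀ t, t ≤ a ∨ b ≤ t → β t = 0 := by
    intro t ht
    refine max_eq_left (mul_nonpos_of_nonneg_of_nonpos (by positivity) ?_)
    rcases ht with h | h
    · exact mul_nonpos_of_nonpos_of_nonneg (by linarith) (by linarith)
    · exact mul_nonpos_of_nonneg_of_nonpos (by linarith) (by linarith)
  set χ : ℝ → ℝ := fun s => β |s| * max 0 (1 - (f s + f (-s)) / θ)
  have hχc : Continuous χ := by fun_prop
  have hχ0 : ∀ s, 0 ≤ χ s := fun s => mul_nonneg (hβ0 _) (le_max_left _ _)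
  have hχ1 : ∀ s, χ s ≤ 1 := fun s => by
    have h1 : max 0 (1 - (f s + f (-s)) / θ) ≤ 1 := by
      refine max_le zero_le_one ?_
      have : 0 ≤ (f s + f (-s)) / θ := div_nonneg (add_nonneg (hf0 _) (hf0 _)) hθ.le
      linarith
    exact mul_le_one₀ (hβ1 _) (le_max_left _ _) h1
  have hχe : ∀ s, χ (-s) = χ s := fun s => by simp only [χ, abs_neg, neg_neg, add_comm]
  have hχoff : ∀ s, |s| ≤ a ∨ b ≤ |s| → χ s = 0 := fun s hs => by
    simp only [χ, hPoff _ hs, zero_mul]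
  have hχf : ∀ s, χ s ≠ 0 → f s ≤ θ := by
    intro s hs
    by_contra! h
    refine hs ?_
    have : max 0 (1 - (f s + f (-s)) / θ) = 0 := by
      refine max_eq_left ?_
      rw [sub_nonpos, one_le_div hθ]
      linarith [hf0 (-s)]
    simp only [χ, this, mul_zero]
  have hii (g : ℝ → ℝ) (hg : Continuous g) (c d : ℝ) : IntervalIntegrable g volume c d :=
    hg.intervalIntegrable c d
  set X : ℝ → ℝ := fun s => ∫ t in (0 : ℝ)..s, χ t
  have hX : ∀ s, HasDerivAt X (χ s) s := fun s =>
    intervalIntegral.integral_hasDerivAt_right (hii χ hχc _ _)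
      (hχc.stronglyMeasurableAtFilter _ _) hχc.continuousAt
  have hXc : Continuous X := continuous_iff_continuousAt.2 fun s => (hX s).continuousAt
  have hX0 : X 0 = 0 := by simp [X]
  have hXmono : Monotone X := monotone_of_deriv_nonneg (fun s => (hX s).differentiableAt)
    fun s => by rw [(hX s).deriv]; exact hχ0 s
  have hXodd : ∀ s, X (-s) = -X s := by
    intro s
    have h := intervalIntegral.integral_comp_neg (a := (0 : ℝ)) (b := s) χ
    simp only [hχe, neg_zero] at h
    simp only [X]
    rw [h, intervalIntegral.integral_symm]
  have hXsub (c d : ℝ) : X d - X c = ∫ t in c..d, χ t := by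
    simp only [X]
    rw [intervalIntegral.integral_interval_sub_left (hii χ hχc _ _) (hii χ hχc _ _)]
  have hXa : X a = 0 := by
    have : X a = ∫ t in (0 : ℝ)..a, (0 : ℝ) := by
      refine intervalIntegral.integral_congr fun t ht => ?_
      rw [Set.uIcc_of_le ha.le] at ht
      exact hχoff t (Or.inl (by rw [abs_of_nonneg ht.1]; exact ht.2))
    simpa using this
  have hXb : ∀ s, b ≤ s → X s = X b := by
    intro s hs
    have h : X s - X b = ∫ t in b..s, (0 : ℝ) := by
      rw [hXsub]
      refine intervalIntegral.integral_congr fun t ht => ?_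
      rw [Set.uIcc_of_le hs] at ht
      exact hχoff t (Or.inr (ht.1.trans (le_abs_self t)))
    simp only [intervalIntegral.integral_zero] at h
    linarith
  have hXbig : R / 12 ≤ X b := by
    have h1 : X b = ∫ t in a..b, χ t := by rw [← hXsub, hXa, sub_zero]
    have h2 : ∫ t in a..b, (P t - θ⁻¹ * (f t + f (-t))) ≤ ∫ t in a..b, χ t := by
      refine intervalIntegral.integral_mono_on hab.le (hii _ (by fun_prop) _ _) (hii χ hχc _ _)
        fun t ht => ?_
      have ht0 : 0 ≤ t := ha.le.trans ht.1
      simp only [χ, abs_of_nonneg ht0]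
      set y := (f t + f (-t)) / θ
      have hy : θ⁻¹ * (f t + f (-t)) = y := by simp only [y]; ring
      have hy0 : 0 ≤ y := div_nonneg (add_nonneg (hf0 _) (hf0 _)) hθ.le
      rw [hy]
      calc P t - y ≤ β t - y := by linarith [le_max_right 0 (P t)]
        _ ≤ β t - β t * y := by nlinarith [hβ1 t]
        _ = β t * (1 - y) := by ring
        _ ≤ _ := mul_le_mul_of_nonneg_left (le_max_right _ _) (hβ0 t)
    have h3 : ∫ t in a..b, P t = R / 6 := by
      have hF : ∀ t ∈ Set.uIcc a b, HasDerivAt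
          (fun t => 64 / R ^ 2 * ((a + b) * t ^ 2 / 2 - t ^ 3 / 3 - a * b * t)) (P t) t := by
        intro t _
        have := ((((hasDerivAt_pow 2 t).const_mul (a + b)).div_const 2).sub
          ((hasDerivAt_pow 3 t).div_const 3)).sub ((hasDerivAt_id t).const_mul (a * b))
        exact (this.const_mul (64 / R ^ 2)).congr_deriv (by
          simp only [P]; push_cast; ring)
      rw [intervalIntegral.integral_eq_sub_of_hasDerivAt hF (hii P hP _ _)]
      simp only [a, b]
      field_simp
      ring
    have h4 : ∫ t in a..b, (f t + f (-t)) ≤ m := by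
      have hfn : Continuous fun t => f (-t) := by fun_prop
      rw [intervalIntegral.integral_add (hii f hf _ _) (hii _ hfn _ _),
        intervalIntegral.integral_comp_neg]
      have e1 := intervalIntegral.integral_add_adjacent_intervals (hii f hf (-R) (-b))
        (hii f hf (-b) (-a))
      have e2 := intervalIntegral.integral_add_adjacent_intervals (hii f hf (-R) (-a))
        (hii f hf (-a) a)
      have e3 := intervalIntegral.integral_add_adjacent_intervals (hii f hf (-R) a)
        (hii f hf a b)
      have e4 := intervalIntegral.integral_add_adjacent_intervals (hii f hf (-R) b)
        (hii f hf b R)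
      have p1 : 0 ≤ ∫ t in (-R)..(-b), f t :=
        intervalIntegral.integral_nonneg (by linarith) fun t _ => hf0 t
      have p2 : 0 ≤ ∫ t in (-a)..a, f t :=
        intervalIntegral.integral_nonneg (by linarith) fun t _ => hf0 t
      have p3 : 0 ≤ ∫ t in b..R, f t :=
        intervalIntegral.integral_nonneg (by linarith) fun t _ => hf0 t
      linarith
    rw [intervalIntegral.integral_sub (hii P hP _ _) (hii _ (by fun_prop) _ _),
      h3, intervalIntegral.integral_const_mul] at h2
    have h5 : θ⁻¹ * ∫ t in a..b, (f t + f (-t)) ≤ R / 12 := by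
      rw [inv_mul_le_iff₀ hθ]; linarith
    rw [h1]; linarith
  set x := X b
  have hx : 0 < x := lt_of_lt_of_le (by positivity) hXbig
  have hXle : ∀ s, |X s| ≤ x := by
    have h1 : ∀ s, X s ≤ x := fun s => by
      rcases le_total s b with h | h
      · exact hXmono h
      · exact (hXb s h).le
    intro s
    rw [abs_le]
    refine ⟨?_, h1 s⟩
    have := h1 (-s)
    rw [hXodd] at this; linarith
  refine ⟨fun s => 1 - (X s / x) ^ 2, fun s => -(2 * X s * χ s / x ^ 2), fun s => ?_, by fun_prop,
    fun s => ?_, fun s => ?_, fun s hs => ?_, fun s hs => ?_, fun s => ?_, fun s hs => ?_⟩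
  · have := (((hX s).div_const x).pow 2).const_sub 1
    refine this.congr_deriv ?_
    simp only [Nat.cast_ofNat, Nat.add_one_sub_one, pow_one]
    field_simp
  · have : (X s / x) ^ 2 ≤ 1 := by
      rw [sq_le_one_iff_abs_le_one, abs_div, abs_of_pos hx]
      exact (div_le_one hx).2 (hXle s)
    simp only; linarith
  · simp only; linarith [sq_nonneg (X s / x)]
  · have h1 : X s ≤ X a := hXmono ((le_abs_self s).trans hs)
    have h2 : X (-s) ≤ X a := hXmono ((neg_le_abs s).trans hs)
    rw [hXodd] at h2
    have : X s = 0 := by linarith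
    simp [this]
  · have : |X s| = x := by
      rcases le_total 0 s with h | h
      · rw [abs_of_nonneg h] at hs
        rw [hXb s hs.le, abs_of_pos hx]
      · rw [abs_of_nonpos h] at hs
        have := hXb (-s) hs.le
        rw [hXodd] at this
        rw [show X s = -x by linarith, abs_neg, abs_of_pos hx]
    have h2 : (X s / x) ^ 2 = 1 := by
      rw [div_pow, ← sq_abs (X s), this, div_self (by positivity)]
    simp only [h2, sub_self]
  · rw [abs_neg, abs_div, abs_mul, abs_mul, abs_two, abs_of_nonneg (hχ0 s),
      abs_of_nonneg (sq_nonneg x)]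
    calc 2 * |X s| * χ s / x ^ 2 ≤ 2 * x * 1 / x ^ 2 := by
          have := hXle s
          have := hχ1 s
          have := hχ0 s
          gcongr
      _ = 2 / x := by field_simp
      _ ≤ 2 / (R / 12) := by gcongr
      _ = 24 / R := by field_simp; norm_num
  · have hχs : χ s ≠ 0 := fun h => hs (by simp [h])
    refine ⟨?_, hχf s hχs⟩
    by_contra! h
    exact hχs (hχoff s (Or.inr h.le))

/-- A slice of small integral stays below a level. -/
lemma slice_le {R τ K : ℝ} (hτ : 0 < τ) (hK : 0 < K) (hτR : τ / (2 * K) ≤ R) {w w' : ℝ → ℝ}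
    (hw : ∀ y, HasDerivAt w (w' y) y) (hw0 : ∀ y, 0 ≤ w y) (hK' : ∀ y, |y| ≤ R → |w' y| ≤ K)
    (h_int : ∫ y in (-R)..R, w y ≤ τ ^ 2 / (8 * K)) {y : ℝ} (hy : |y| ≤ R) : w y ≤ τ := by
  by_contra! hc
  set d := τ / (2 * K)
  have hd : 0 < d := by positivity
  have hwc : Continuous w := continuous_iff_continuousAt.2 fun s => (hw s).continuousAt
  have hlip : ∀ z, |z| ≤ R → |z - y| ≤ d → τ / 2 ≤ w z := by
    intro z hz hzy
    have h1 := (convex_Icc (-R) R).norm_image_sub_le_of_norm_hasDerivWithin_le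
      (fun t _ => (hw t).hasDerivWithinAt) (fun t ht => hK' t (abs_le.2 ht))
      (abs_le.1 hy) (abs_le.1 hz)
    rw [Real.norm_eq_abs, Real.norm_eq_abs] at h1
    have h2 := (abs_le.1 h1).1
    have h3 : K * |z - y| ≤ K * d := by gcongr
    have h4 : K * d = τ / 2 := by simp only [d]; field_simp
    linarith
  have hii (c e : ℝ) : IntervalIntegrable w volume c e := hwc.intervalIntegrable c e
  have hsub : ∀ c, -R ≤ c → c + d ≤ R → (∀ z ∈ Set.Icc c (c + d), |z - y| ≤ d) → False := by
    intro c hc1 hc2 hz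
    have h1 : ∫ z in c..(c + d), τ / 2 ≤ ∫ z in c..(c + d), w z :=
      intervalIntegral.integral_mono_on (by linarith) (by simp) (hii _ _) fun z hzI =>
        hlip z (abs_le.2 ⟨hc1.trans hzI.1, hzI.2.trans hc2⟩) (hz z hzI)
    rw [intervalIntegral.integral_const, add_sub_cancel_left, smul_eq_mul] at h1
    have e1 := intervalIntegral.integral_add_adjacent_intervals (hii (-R) c) (hii c (c + d))
    have e2 := intervalIntegral.integral_add_adjacent_intervals (hii (-R) (c + d)) (hii (c + d) R)
    have p1 : 0 ≤ ∫ t in (-R)..c, w t :=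
      intervalIntegral.integral_nonneg hc1 fun t _ => hw0 t
    have p2 : 0 ≤ ∫ t in (c + d)..R, w t :=
      intervalIntegral.integral_nonneg hc2 fun t _ => hw0 t
    have h2 : d * (τ / 2) = τ ^ 2 / (8 * K) + τ ^ 2 / (8 * K) := by
      simp only [d]; field_simp; norm_num
    have h3 : 0 < τ ^ 2 / (8 * K) := by positivity
    linarith
  have hy' := abs_le.1 hy
  rcases le_total y 0 with h | h
  · exact hsub y hy'.1 (by linarith) fun z hz => abs_le.2 ⟨by linarith [hz.1], by linarith [hz.2]⟩
  · exact hsub (y - d) (by linarith) (by linarith) fun z hz =>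
      abs_le.2 ⟨by linarith [hz.1], by linarith [hz.2]⟩

end AllenCahn

namespace AllenCahn

section Pohozaev

variable {k : ℕ} {V : Evec k → ℝ} {U : ℝ × ℝ → Evec k} {R ρ : ℝ}

/-- The Pohozaev inequality obtained by testing the equation with `φ p • ∇U`. -/
lemma pohozaev (hV : ContDiff ℝ (⊤ : ℕ∞) V) (h0 : ∀ y, 0 ≤ V y) (hU : BoundedSolution V U R ρ)
    {φ : ℝ × ℝ → ℝ} (hφ : ContDiff ℝ 1 φ) (hoff : ∀ p, p ∉ Sq R → φ p = 0) :
    ∫ p in Sq R, φ p * V (U p) ≤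
      ∫ p in Sq R, R * (|dd e₁ φ p| + |dd e₂ φ p|) * en V U p := by
  set P := dd e₁ U
  set Q := dd e₂ U
  have hPs : ContDiff ℝ (⊤ : ℕ∞) P := contDiff_dd hU.smooth e₁
  have hQs : ContDiff ℝ (⊤ : ℕ∞) Q := contDiff_dd hU.smooth e₂
  have hPd := differentiable_of_smooth hPs
  have hQd := differentiable_of_smooth hQs
  have hvs : ContDiff ℝ (⊤ : ℕ∞) fun p => V (U p) := hV.comp hU.smooth
  have hPP : ContDiff ℝ (⊤ : ℕ∞) fun p => ⟪P p, P p⟫ := hPs.inner ℝ hPs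
  have hQQ : ContDiff ℝ (⊤ : ℕ∞) fun p => ⟪Q p, Q p⟫ := hQs.inner ℝ hQs
  have hPQ : ContDiff ℝ (⊤ : ℕ∞) fun p => ⟪P p, Q p⟫ := hPs.inner ℝ hQs
  set T₁ : ℝ × ℝ → ℝ := fun p => 1 / 2 * (⟪Q p, Q p⟫ - ⟪P p, P p⟫) + V (U p)
  set T₂ : ℝ × ℝ → ℝ := fun p => 1 / 2 * (⟪P p, P p⟫ - ⟪Q p, Q p⟫) + V (U p)
  set T : ℝ × ℝ → ℝ := fun p => -1 * ⟪P p, Q p⟫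
  have hT₁ : ContDiff ℝ (⊤ : ℕ∞) T₁ := (contDiff_const.mul (hQQ.sub hPP)).add hvs
  have hT₂ : ContDiff ℝ (⊤ : ℕ∞) T₂ := (contDiff_const.mul (hPP.sub hQQ)).add hvs
  have hT : ContDiff ℝ (⊤ : ℕ∞) T := contDiff_const.mul hPQ
  have hc (c : ℝ) (v p : ℝ × ℝ) : dd v (fun _ : ℝ × ℝ => c) p = 0 := by simp [dd]
  have dT₁ (v p : ℝ × ℝ) : dd v T₁ p =
      ⟪Q p, dd v Q p⟫ - ⟪P p, dd v P p⟫ + ⟪gradient V (U p), dd v U p⟫ := by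
    simp only [T₁]
    rw [dd_add (differentiable_of_smooth (contDiff_const.mul (hQQ.sub hPP)))
      (differentiable_of_smooth hvs), dd_mul (differentiable_const _)
      (differentiable_of_smooth (hQQ.sub hPP)), dd_sub (differentiable_of_smooth hQQ)
      (differentiable_of_smooth hPP), dd_inner hQd hQd, dd_inner hPd hPd, hc,
      dd_potential hV hU.smooth, real_inner_comm (Q p), real_inner_comm (P p)]
    ring
  have dT₂ (v p : ℝ × ℝ) : dd v T₂ p =
      ⟪P p, dd v P p⟫ - ⟪Q p, dd v Q p⟫ + ⟪gradient V (U p), dd v U p⟫ := by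
    simp only [T₂]
    rw [dd_add (differentiable_of_smooth (contDiff_const.mul (hPP.sub hQQ)))
      (differentiable_of_smooth hvs), dd_mul (differentiable_const _)
      (differentiable_of_smooth (hPP.sub hQQ)), dd_sub (differentiable_of_smooth hPP)
      (differentiable_of_smooth hQQ), dd_inner hQd hQd, dd_inner hPd hPd, hc,
      dd_potential hV hU.smooth, real_inner_comm (Q p), real_inner_comm (P p)]
    ring
  have dT (v p : ℝ × ℝ) : dd v T p = -(⟪P p, dd v Q p⟫ + ⟪dd v P p, Q p⟫) := by
    simp only [T]
    rw [dd_mul (differentiable_const _) (differentiable_of_smooth hPQ), dd_inner hPd hQd, hc]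
    ring
  have hcomm (p : ℝ × ℝ) : dd e₁ Q p = dd e₂ P p := dd_comm hU.smooth e₁ e₂ p
  have heq : ∀ p ∈ Sq R, gradient V (U p) = dd e₁ P p + dd e₂ Q p := fun p hp =>
    (hU.eq p hp).symm
  have hdiv₁ : ∀ p ∈ Sq R, dd e₁ T₁ p + dd e₂ T p = 0 := by
    intro p hp
    have : dd e₁ U p = P p := rfl
    rw [dT₁, dT, heq p hp, hcomm, this, inner_add_left, real_inner_comm (P p) (dd e₁ P p),
      real_inner_comm (P p) (dd e₂ Q p), real_inner_comm (Q p) (dd e₂ P p)]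
    ring
  have hdiv₂ : ∀ p ∈ Sq R, dd e₁ T p + dd e₂ T₂ p = 0 := by
    intro p hp
    have : dd e₂ U p = Q p := rfl
    rw [dT₂, dT, heq p hp, hcomm, this, inner_add_left, real_inner_comm (Q p) (dd e₁ P p),
      real_inner_comm (Q p) (dd e₂ Q p)]
    ring
  have hx : ContDiff ℝ 1 fun p : ℝ × ℝ => p.1 * φ p := contDiff_fst.mul hφ
  have hy : ContDiff ℝ 1 fun p : ℝ × ℝ => p.2 * φ p := contDiff_snd.mul hφ
  have hxoff : ∀ p, p ∉ Sq R → p.1 * φ p = 0 := fun p hp => by rw [hoff p hp, mul_zero]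
  have hyoff : ∀ p, p ∉ Sq R → p.2 * φ p = 0 := fun p hp => by rw [hoff p hp, mul_zero]
  have hφd : Differentiable ℝ φ := hφ.differentiable (by simp)
  have hφx (v p : ℝ × ℝ) : dd v (fun p : ℝ × ℝ => p.1 * φ p) p = p.1 * dd v φ p + v.1 * φ p := by
    rw [dd_mul differentiable_fst hφd]; simp [dd, fderiv_fst]
  have hφy (v p : ℝ × ℝ) : dd v (fun p : ℝ × ℝ => p.2 * φ p) p = p.2 * dd v φ p + v.2 * φ p := by
    rw [dd_mul differentiable_snd hφd]; simp [dd, fderiv_snd]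
  have h_int {f : ℝ × ℝ → ℝ} (hf : Continuous f) {g : ℝ × ℝ → ℝ} (hg : Continuous g)
      (h : ∀ p, p ∉ Sq R → f p = 0) : Integrable fun p => f p * g p :=
    continuous_hasCompactSupport_integrable (hf.mul hg) fun p hp => by rw [h p hp, zero_mul]
  have hdc {f : ℝ × ℝ → ℝ} (hf : ContDiff ℝ (⊤ : ℕ∞) f) (v : ℝ × ℝ) : Continuous (dd v f) :=
    (contDiff_dd hf v).continuous
  set D : ℝ × ℝ → ℝ := fun p =>
    dd e₁ (fun p : ℝ × ℝ => p.1 * φ p) p * T₁ p + dd e₂ (fun p : ℝ × ℝ => p.1 * φ p) p * T p +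
    (dd e₁ (fun p : ℝ × ℝ => p.2 * φ p) p * T p + dd e₂ (fun p : ℝ × ℝ => p.2 * φ p) p * T₂ p)
  have hDc : Continuous D :=
    (((continuous_dd hx _).mul hT₁.continuous).add ((continuous_dd hx _).mul hT.continuous)).add
      (((continuous_dd hy _).mul hT.continuous).add ((continuous_dd hy _).mul hT₂.continuous))
  have hDoff : ∀ p, p ∉ Sq R → D p = 0 := fun p hp => by
    simp only [D]
    rw [dd_eq_zero_of_notMem hxoff _ p hp, dd_eq_zero_of_notMem hxoff _ p hp,
      dd_eq_zero_of_notMem hyoff _ p hp, dd_eq_zero_of_notMem hyoff _ p hp]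
    ring
  have hD : ∫ p in Sq R, D p = 0 := by
    rw [setIntegral_eq_integral_of_forall_compl_eq_zero hDoff]
    simp only [D]
    have i1 := h_int (continuous_dd hx e₁) hT₁.continuous (dd_eq_zero_of_notMem hxoff e₁)
    have i2 := h_int (continuous_dd hx e₂) hT.continuous (dd_eq_zero_of_notMem hxoff e₂)
    have i3 := h_int (continuous_dd hy e₁) hT.continuous (dd_eq_zero_of_notMem hyoff e₁)
    have i4 := h_int (continuous_dd hy e₂) hT₂.continuous (dd_eq_zero_of_notMem hyoff e₂)
    have j1 := h_int hx.continuous (hdc hT₁ e₁) hxoff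
    have j2 := h_int hx.continuous (hdc hT e₂) hxoff
    have j3 := h_int hy.continuous (hdc hT e₁) hyoff
    have j4 := h_int hy.continuous (hdc hT₂ e₂) hyoff
    have s1 := integral_mul_dd hx (contDiff_one_of_smooth hT₁) hxoff e₁
    have s2 := integral_mul_dd hx (contDiff_one_of_smooth hT) hxoff e₂
    have s3 := integral_mul_dd hy (contDiff_one_of_smooth hT) hyoff e₁
    have s4 := integral_mul_dd hy (contDiff_one_of_smooth hT₂) hyoff e₂
    have z1 : (∫ p : ℝ × ℝ, p.1 * φ p * dd e₁ T₁ p) + (∫ p : ℝ × ℝ, p.1 * φ p * dd e₂ T p) = 0 := by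
      rw [← integral_add j1 j2]
      refine integral_eq_zero_of_ae (Eventually.of_forall fun p => ?_)
      by_cases hp : p ∈ Sq R
      · simp only [← mul_add, hdiv₁ p hp, mul_zero, Pi.zero_apply]
      · simp [hoff p hp]
    have z2 : (∫ p : ℝ × ℝ, p.2 * φ p * dd e₁ T p) + (∫ p : ℝ × ℝ, p.2 * φ p * dd e₂ T₂ p) = 0 := by
      rw [← integral_add j3 j4]
      refine integral_eq_zero_of_ae (Eventually.of_forall fun p => ?_)
      by_cases hp : p ∈ Sq R
      · simp only [← mul_add, hdiv₂ p hp, mul_zero, Pi.zero_apply]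
      · simp [hoff p hp]
    refine (integral_add (i1.add i2) (i3.add i4)).trans ?_
    rw [integral_add' i1 i2, integral_add' i3 i4]
    linarith
  have hen := continuous_en hV hU.smooth
  have hBc : Continuous fun p => R * (|dd e₁ φ p| + |dd e₂ φ p|) * en V U p :=
    (continuous_const.mul ((continuous_dd hφ _).abs.add (continuous_dd hφ _).abs)).mul hen
  have hA := integrableOn_Sq (hDc.const_mul (1 / 2)) R
  calc ∫ p in Sq R, φ p * V (U p)
      ≤ ∫ p in Sq R, (1 / 2 * D p + R * (|dd e₁ φ p| + |dd e₂ φ p|) * en V U p) := by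
        refine setIntegral_mono_on (integrableOn_Sq (hφ.continuous.mul hvs.continuous) R)
          (hA.add (integrableOn_Sq hBc R)) (measurableSet_Sq R) fun p hp => ?_
        obtain ⟨hp1, hp2⟩ := mem_Sq.1 hp
        have hDp : D p = 2 * (φ p * V (U p)) + (p.1 * dd e₁ φ p * T₁ p +
            (p.1 * dd e₂ φ p + p.2 * dd e₁ φ p) * T p + p.2 * dd e₂ φ p * T₂ p) := by
          simp only [D, hφx, hφy, T₁, T₂]
          ring
        have hv0 := h0 (U p)
        have henp : en V U p = (‖P p‖ ^ 2 + ‖Q p‖ ^ 2) / 2 + V (U p) := rfl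
        have hPQi := abs_le.1 (abs_real_inner_le_norm (P p) (Q p))
        have b1 : |T₁ p| ≤ en V U p := by
          simp only [T₁, real_inner_self_eq_norm_sq, henp]
          rw [abs_le]; constructor <;> nlinarith [sq_nonneg ‖P p‖, sq_nonneg ‖Q p‖]
        have b2 : |T₂ p| ≤ en V U p := by
          simp only [T₂, real_inner_self_eq_norm_sq, henp]
          rw [abs_le]; constructor <;> nlinarith [sq_nonneg ‖P p‖, sq_nonneg ‖Q p‖]
        have b3 : |T p| ≤ en V U p := by
          simp only [T, henp]
          rw [abs_le]; constructor <;> nlinarith [sq_nonneg (‖P p‖ - ‖Q p‖)]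
        have hE := en_nonneg (U := U) h0 p
        have key {x d t : ℝ} (hx : |x| ≤ R) (ht : |t| ≤ en V U p) :
            -(R * |d| * en V U p) ≤ x * d * t := by
          refine (abs_le.1 ?_).1
          rw [abs_mul, abs_mul]
          have : 0 ≤ |d| := abs_nonneg d
          have : 0 ≤ R := (abs_nonneg x).trans hx
          gcongr
        have k1 := key (d := dd e₁ φ p) hp1 b1
        have k2 := key (d := dd e₂ φ p) hp1 b3
        have k3 := key (d := dd e₁ φ p) hp2 b3
        have k4 := key (d := dd e₂ φ p) hp2 b2
        rw [hDp]
        linarith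
    _ = _ := by
        rw [integral_add hA (integrableOn_Sq hBc R), integral_const_mul, hD, mul_zero, zero_add]

/-- The potential energy is controlled by the energy in the low-potential region. -/
lemma potential_le_energy_low (hV : ContDiff ℝ (⊤ : ℕ∞) V) (h0 : ∀ y, 0 ≤ V y) (hR : 0 < R)
    (hU : BoundedSolution V U R ρ) {K τ : ℝ} (hK : 0 < K) (hτ : 0 < τ) (hτR : τ / (2 * K) ≤ R)
    (hK₁ : ∀ p ∈ Sq R, |dd e₁ (fun q => V (U q)) p| ≤ K)
    (hK₂ : ∀ p ∈ Sq R, |dd e₂ (fun q => V (U q)) p| ≤ K)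
    (hE : ∫ p in Sq R, en V U p ≤ R / 12 * (τ ^ 2 / (8 * K))) :
    ∫ p in Sq (1 / 2 * R), V (U p) ≤
      48 * ∫ p in Sq (3 / 4 * R), {q | V (U q) ≤ τ}.indicator (en V U) p := by
  have hvs : ContDiff ℝ (⊤ : ℕ∞) fun p => V (U p) := hV.comp hU.smooth
  have hvd := differentiable_of_smooth hvs
  have hen := continuous_en hV hU.smooth
  have hvE : ∫ p in Sq R, V (U p) ≤ R / 12 * (τ ^ 2 / (8 * K)) :=
    (setIntegral_mono_on (integrableOn_Sq hvs.continuous R) (integrableOn_Sq hen R)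
      (measurableSet_Sq R) fun p _ => potential_le_en p).trans hE
  have hIcc : Set.Icc (-R) R = closedBall (0 : ℝ) R := by rw [Real.closedBall_eq_Icc]; simp
  have hSq : Sq R = Set.Icc (-R) R ×ˢ Set.Icc (-R) R := by
    rw [hIcc, closedBall_prod_same]; rfl
  have hii (g : ℝ → ℝ) : ∫ s in (-R)..R, g s = ∫ s in Set.Icc (-R) R, g s := by
    rw [intervalIntegral.integral_of_le (by linarith), integral_Icc_eq_integral_Ioc]
  have hF₁ : ∫ s in (-R)..R, ∫ y in (-R)..R, V (U (s, y)) = ∫ p in Sq R, V (U p) := by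
    simp only [hii]
    rw [hSq, Measure.volume_eq_prod, setIntegral_prod]
    rw [← Measure.volume_eq_prod, ← hSq]
    exact integrableOn_Sq hvs.continuous R
  have hF₂ : ∫ s in (-R)..R, ∫ y in (-R)..R, V (U (y, s)) = ∫ p in Sq R, V (U p) := by
    rw [← hF₁]
    simp only [hii]
    refine integral_integral_swap ?_
    rw [Measure.prod_restrict, ← Measure.volume_eq_prod, ← hSq]
    exact integrableOn_Sq (f := fun p => V (U p.swap))
      (hvs.continuous.comp continuous_swap) R
  have hc₁ : Continuous fun s => ∫ y in (-R)..R, V (U (s, y)) :=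
    intervalIntegral.continuous_parametric_intervalIntegral_of_continuous'
      (f := fun s y => V (U (s, y))) hvs.continuous _ _
  have hc₂ : Continuous fun s => ∫ y in (-R)..R, V (U (y, s)) :=
    intervalIntegral.continuous_parametric_intervalIntegral_of_continuous'
      (f := fun s y => V (U (y, s))) (hvs.continuous.comp continuous_swap) _ _
  have hθ : 0 < τ ^ 2 / (8 * K) := by positivity
  obtain ⟨φ, φ', hφ, hφ'c, hφ0, hφ1, hφe, hφoff, hφ'l, hφ's⟩ := exists_line_cutoff hR hθ hc₁
    (fun s => intervalIntegral.integral_nonneg (by linarith) fun _ _ => h0 _) (hF₁.trans_le hvE)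
    le_rfl
  obtain ⟨ψ, ψ', hψ, hψ'c, hψ0, hψ1, hψe, hψoff, hψ'l, hψ's⟩ := exists_line_cutoff hR hθ hc₂
    (fun s => intervalIntegral.integral_nonneg (by linarith) fun _ _ => h0 _) (hF₂.trans_le hvE)
    le_rfl
  have hC1 {f f' : ℝ → ℝ} (h : ∀ s, HasDerivAt f (f' s) s) (hc : Continuous f') : ContDiff ℝ 1 f := by
    rw [contDiff_one_iff_deriv]
    exact ⟨fun s => (h s).differentiableAt, by rwa [show deriv f = f' from funext fun s => (h s).deriv]⟩
  set Φ : ℝ × ℝ → ℝ := fun p => φ p.1 * ψ p.2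
  have hΦ : ContDiff ℝ 1 Φ := ((hC1 hφ hφ'c).comp contDiff_fst).mul ((hC1 hψ hψ'c).comp contDiff_snd)
  have hΦd : Differentiable ℝ Φ := hΦ.differentiable (by simp)
  have hΦ₁ (p : ℝ × ℝ) : dd e₁ Φ p = φ' p.1 * ψ p.2 :=
    dd_fst_eq hΦd ((hφ p.1).mul_const (ψ p.2))
  have hΦ₂ (p : ℝ × ℝ) : dd e₂ Φ p = φ p.1 * ψ' p.2 :=
    dd_snd_eq hΦd ((hψ p.2).const_mul (φ p.1))
  have hoff' : ∀ p, p ∉ Sq (3 / 4 * R) → Φ p = 0 := by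
    intro p hp
    rw [mem_Sq, not_and_or, not_le, not_le] at hp
    rcases hp with h | h
    · simp only [Φ, hφoff _ h, zero_mul]
    · simp only [Φ, hψoff _ h, mul_zero]
  have hoff : ∀ p, p ∉ Sq R → Φ p = 0 := fun p hp =>
    hoff' p fun h => hp (Sq_mono (by linarith) h)
  have hΦ0 (p : ℝ × ℝ) : 0 ≤ Φ p := mul_nonneg (hφ0 _) (hψ0 _)
  have hpoh := pohozaev hV h0 hU hΦ hoff
  have hmeas : MeasurableSet {q | V (U q) ≤ τ} :=
    (isClosed_le hvs.continuous continuous_const).measurableSet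
  set I : ℝ × ℝ → ℝ := (Sq (3 / 4 * R)).indicator ({q | V (U q) ≤ τ}.indicator (en V U))
  have hI : IntegrableOn I (Sq R) :=
    ((integrableOn_Sq hen R).indicator hmeas).indicator (measurableSet_Sq _)
  have hE0 (p : ℝ × ℝ) : 0 ≤ en V U p := en_nonneg h0 p
  have hI0 (p : ℝ × ℝ) : 0 ≤ I p :=
    Set.indicator_nonneg (fun p _ => Set.indicator_nonneg (fun p _ => hE0 p) p) p
  have hIeq {p : ℝ × ℝ} (h1 : |p.1| ≤ 3 / 4 * R) (h2 : |p.2| ≤ 3 / 4 * R) (h3 : V (U p) ≤ τ) :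
      I p = en V U p := by
    simp only [I]
    rw [Set.indicator_of_mem (mem_Sq.2 ⟨h1, h2⟩), Set.indicator_of_mem
      (show p ∈ {q | V (U q) ≤ τ} from h3)]
  have hlow₁ (p : ℝ × ℝ) : |dd e₁ Φ p| * en V U p ≤ 24 / R * I p := by
    by_cases h : dd e₁ Φ p = 0
    · rw [h, abs_zero, zero_mul]; exact mul_nonneg (by positivity) (hI0 p)
    rw [hΦ₁] at h ⊢
    obtain ⟨ha, hf⟩ := hφ's _ (left_ne_zero_of_mul h)
    have hb : |p.2| ≤ 3 / 4 * R := by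
      by_contra! hb
      exact h (by rw [hψoff _ hb, mul_zero])
    have hv : V (U p) ≤ τ :=
      slice_le hτ hK hτR (fun y => hasDerivAt_snd hvd p.1 y) (fun _ => h0 _)
        (fun y hy => hK₂ _ (mem_Sq.2 ⟨by simp only; linarith, hy⟩)) hf (by linarith)
    rw [hIeq ha hb hv, abs_mul, abs_of_nonneg (hψ0 _)]
    refine mul_le_mul_of_nonneg_right ?_ (hE0 p)
    calc |φ' p.1| * ψ p.2 ≤ |φ' p.1| * 1 := by gcongr; exact hψ1 _
      _ ≤ 24 / R := by rw [mul_one]; exact hφ'l _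
  have hlow₂ (p : ℝ × ℝ) : |dd e₂ Φ p| * en V U p ≤ 24 / R * I p := by
    by_cases h : dd e₂ Φ p = 0
    · rw [h, abs_zero, zero_mul]; exact mul_nonneg (by positivity) (hI0 p)
    rw [hΦ₂] at h ⊢
    obtain ⟨hb, hf⟩ := hψ's _ (right_ne_zero_of_mul h)
    have ha : |p.1| ≤ 3 / 4 * R := by
      by_contra! ha
      exact h (by rw [hφoff _ ha, zero_mul])
    have hv : V (U p) ≤ τ :=
      slice_le hτ hK hτR (fun y => hasDerivAt_fst hvd y p.2) (fun _ => h0 _)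
        (fun y hy => hK₁ _ (mem_Sq.2 ⟨hy, by simp only; linarith⟩)) hf (by linarith)
    rw [hIeq ha hb hv, abs_mul, abs_of_nonneg (hφ0 _)]
    refine mul_le_mul_of_nonneg_right ?_ (hE0 p)
    calc φ p.1 * |ψ' p.2| ≤ 1 * |ψ' p.2| := by gcongr; exact hφ1 _
      _ ≤ 24 / R := by rw [one_mul]; exact hψ'l _
  have hΦv : IntegrableOn (fun p => Φ p * V (U p)) (Sq R) :=
    integrableOn_Sq (hΦ.continuous.mul hvs.continuous) R
  calc ∫ p in Sq (1 / 2 * R), V (U p) = ∫ p in Sq (1 / 2 * R), Φ p * V (U p) := by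
        refine setIntegral_congr_fun (measurableSet_Sq _) fun p hp => ?_
        obtain ⟨h1, h2⟩ := mem_Sq.1 hp
        simp only [Φ]
        rw [hφe _ (by linarith), hψe _ (by linarith), one_mul, one_mul]
    _ ≤ ∫ p in Sq R, Φ p * V (U p) :=
        setIntegral_mono_set hΦv (Eventually.of_forall fun p => mul_nonneg (hΦ0 p) (h0 _))
          (Eventually.of_forall (Sq_mono (by linarith)))
    _ ≤ ∫ p in Sq R, R * (|dd e₁ Φ p| + |dd e₂ Φ p|) * en V U p := hpoh
    _ ≤ ∫ p in Sq R, 48 * I p := by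
        refine setIntegral_mono_on (integrableOn_Sq ((continuous_const.mul
          ((continuous_dd hΦ _).abs.add (continuous_dd hΦ _).abs)).mul hen) R)
          (hI.const_mul 48) (measurableSet_Sq R) fun p _ => ?_
        calc R * (|dd e₁ Φ p| + |dd e₂ Φ p|) * en V U p
            = R * (|dd e₁ Φ p| * en V U p + |dd e₂ Φ p| * en V U p) := by ring
          _ ≤ R * (24 / R * I p + 24 / R * I p) := by
              gcongr ?_ * (?_ + ?_)
              exacts [hlow₁ p, hlow₂ p]
          _ = 48 * I p := by field_simp; ring
    _ = _ := by
        rw [integral_const_mul, setIntegral_indicator (measurableSet_Sq _),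
          Set.inter_eq_right.2 (Sq_mono (by linarith))]

end Pohozaev

end AllenCahn

namespace AllenCahn

section ClearingOut

variable {k : ℕ} {V : Evec k → ℝ} {U : ℝ × ℝ → Evec k} {R ρ l Λ L τ₀ : ℝ}

lemma BoundedSolution.mono (hU : BoundedSolution V U R ρ) {r : ℝ} (h : r ≤ R) :
    BoundedSolution V U r ρ :=
  ⟨hU.smooth, fun p hp => hU.eq p (Sq_mono h hp), fun p hp => hU.bound p (Sq_mono h hp)⟩

/-- If the energy on a large square is small relative to its size, it decays geometrically. -/
lemma exists_energy_decay (hP : PotentialBounds V ρ l Λ L τ₀) {G L₀ : ℝ} (hG : 0 < G)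
    (hGV : ∀ y, ‖y‖ ≤ ρ → ‖gradient V y‖ ≤ G) (hL₀ : 0 < L₀) :
    ∃ K ≥ (4 : ℝ), ∃ η > (0 : ℝ), ∀ R ≥ K, ∀ U : ℝ × ℝ → Evec k, BoundedSolution V U R ρ →
      (∀ p ∈ Sq R, ‖dd e₁ U p‖ ≤ L₀) → (∀ p ∈ Sq R, ‖dd e₂ U p‖ ≤ L₀) →
      ∫ p in Sq R, en V U p ≤ η * R →
      ∫ p in Sq (R / 4), en V U p ≤ (∫ p in Sq R, en V U p) / 4 := by
  obtain ⟨C₁, hC₁, b, hb, hlow⟩ := exists_energy_low hP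
  obtain ⟨C₂, hC₂, hpot⟩ := exists_energy_le_potential hP L₀
  have hτ₀ := hP.τ₀_pos
  set C := 48 * C₁ * C₂
  have hC : 0 < C := by positivity
  set M := G * L₀
  have hM : 0 < M := by positivity
  set σ := min 1 ((1 / (8 * C)) ^ (1 / b))
  have hσ : 0 < σ := lt_min one_pos (Real.rpow_pos_of_pos (by positivity) _)
  have hσb : σ ^ b ≤ 1 / (8 * C) := by
    calc σ ^ b ≤ ((1 / (8 * C)) ^ (1 / b)) ^ b :=
          Real.rpow_le_rpow hσ.le (min_le_right _ _) hb.le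
      _ = 1 / (8 * C) := by
          rw [← Real.rpow_mul (by positivity), one_div_mul_cancel hb.ne', Real.rpow_one]
  set τ := τ₀ * σ
  have hτ : 0 < τ := by positivity
  have hττ₀ : τ ≤ τ₀ := mul_le_of_le_one_right hτ₀.le (min_le_left _ _)
  have hτσ : τ / τ₀ = σ := mul_div_cancel_left₀ _ hτ₀.ne'
  refine ⟨max 4 (max (8 * C) (τ / (2 * M))), le_max_left _ _, 1 / 12 * (τ ^ 2 / (8 * M)),
    by positivity, fun R hR U hU h1 h2 hE => ?_⟩
  have hR4 : 4 ≤ R := (le_max_left _ _).trans hR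
  have hRC : 8 * C ≤ R := ((le_max_left _ _).trans (le_max_right _ _)).trans hR
  have hRτ : τ / (2 * M) ≤ R := ((le_max_right _ _).trans (le_max_right _ _)).trans hR
  have hR0 : 0 < R := by linarith
  have hen := continuous_en hP.smooth hU.smooth
  have hdv {w : ℝ × ℝ} (h : ∀ p ∈ Sq R, ‖dd w U p‖ ≤ L₀) :
      ∀ p ∈ Sq R, |dd w (fun q => V (U q)) p| ≤ M := fun p hp => by
    rw [dd_potential hP.smooth hU.smooth]
    exact (abs_real_inner_le_norm _ _).trans
      (mul_le_mul (hGV _ (hU.bound p hp)) (h p hp) (norm_nonneg _) hG.le)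
  have k1 := potential_le_energy_low hP.smooth hP.nonneg hR0 hU hM hτ hRτ (hdv h1) (hdv h2)
    (by linarith)
  have k2 := hlow τ hτ hττ₀ R hR0 U hU
  have hhalf : Sq (1 / 2 * R) ⊆ Sq R := Sq_mono (by linarith)
  have k3 := hpot (1 / 2 * R) (by linarith) U (hU.mono (by linarith))
    (fun p hp => h1 p (hhalf hp)) (fun p hp => h2 p (hhalf hp))
  have k4 : ∫ p in Sq (R / 4), en V U p ≤ ∫ p in Sq (3 / 4 * (1 / 2 * R)), en V U p :=
    setIntegral_mono_set (integrableOn_Sq hen _)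
      (Eventually.of_forall fun p => en_nonneg hP.nonneg p)
      (Eventually.of_forall (Sq_mono (by linarith)))
  have hE0 : 0 ≤ ∫ p in Sq R, en V U p := integral_nonneg fun p => en_nonneg hP.nonneg p
  have hR2 : 1 / R ^ 2 ≤ 1 / (8 * C) := by
    refine one_div_le_one_div_of_le (by positivity) ?_
    nlinarith
  rw [hτσ] at k2
  calc ∫ p in Sq (R / 4), en V U p
      ≤ C₂ * (48 * (C₁ * (1 / R ^ 2 + σ ^ b) * ∫ p in Sq R, en V U p)) := by
        refine k4.trans (k3.trans ?_)
        gcongr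
        exact k1.trans (by gcongr)
    _ = C * (1 / R ^ 2 + σ ^ b) * ∫ p in Sq R, en V U p := by simp only [C]; ring
    _ ≤ C * (1 / (8 * C) + 1 / (8 * C)) * ∫ p in Sq R, en V U p := by gcongr
    _ = _ := by field_simp; ring

/-- A solution with small relative energy has small potential at the centre. -/
lemma exists_clearing_out (hP : PotentialBounds V ρ l Λ L τ₀) {G L₀ : ℝ} (hG : 0 < G)
    (hGV : ∀ y, ‖y‖ ≤ ρ → ‖gradient V y‖ ≤ G) (hL₀ : 0 < L₀) {r₀ : ℝ} (hr₀ : 0 < r₀)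
    (hr₀1 : r₀ ≤ 1) :
    ∃ η > (0 : ℝ), ∀ R ≥ r₀, ∀ U : ℝ × ℝ → Evec k, BoundedSolution V U R ρ →
      (∀ p ∈ Sq R, ‖dd e₁ U p‖ ≤ L₀) → (∀ p ∈ Sq R, ‖dd e₂ U p‖ ≤ L₀) →
      ∫ p in Sq R, en V U p ≤ η * R → V (U 0) < τ₀ := by
  obtain ⟨K, hK, η, hη, hdecay⟩ := exists_energy_decay hP hG hGV hL₀
  have hτ₀ := hP.τ₀_pos
  set M := G * L₀
  have hM : 0 < M := by positivity
  set d := min r₀ (τ₀ / (4 * M))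
  have hd : 0 < d := by positivity
  set v := volume.real (Sq d)
  have hv : 0 < v := ENNReal.toReal_pos (measure_closedBall_pos volume 0 hd).ne'
    (isCompact_Sq d).measure_lt_top.ne
  set η' := min η (τ₀ / 2 * v / (2 * K))
  have hη' : 0 < η' := lt_min hη (by positivity)
  refine ⟨η', hη', fun R hR => ?_⟩
  obtain ⟨n, hn⟩ : ∃ n : ℕ, R ≤ 4 ^ n * K := by
    obtain ⟨n, hn⟩ := pow_unbounded_of_one_lt R (by norm_num : (1 : ℝ) < 4)
    exact ⟨n, hn.le.trans (le_mul_of_one_le_right (by positivity) (by linarith))⟩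
  induction n generalizing R with
  | zero =>
    intro U hU h1 h2 hE
    by_contra! hc
    rw [pow_zero, one_mul] at hn
    have hv0 : ContDiff ℝ (⊤ : ℕ∞) fun p => V (U p) := hP.smooth.comp hU.smooth
    have hdR : d ≤ R := (min_le_left _ _).trans hR
    have hdv {w : ℝ × ℝ} (h : ∀ p ∈ Sq R, ‖dd w U p‖ ≤ L₀) :
        ∀ p ∈ Sq R, |dd w (fun q => V (U q)) p| ≤ M := fun p hp => by
      rw [dd_potential hP.smooth hU.smooth]
      exact (abs_real_inner_le_norm _ _).trans
        (mul_le_mul (hGV _ (hU.bound p hp)) (h p hp) (norm_nonneg _) hG.le)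
    have hbig : ∀ p ∈ Sq d, τ₀ / 2 ≤ V (U p) := by
      intro p hp
      have hf : ∀ q ∈ Sq d, ‖fderiv ℝ (fun q => V (U q)) q‖ ≤ 2 * M := by
        intro q hq
        refine ContinuousLinearMap.opNorm_le_bound _ (by positivity) fun w => ?_
        rw [apply_eq_dd]
        have a1 := hdv h1 q (Sq_mono hdR hq)
        have a2 := hdv h2 q (Sq_mono hdR hq)
        have w1 : |w.1| ≤ ‖w‖ := norm_fst_le w
        have w2 : |w.2| ≤ ‖w‖ := norm_snd_le w
        refine (norm_add_le _ _).trans ?_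
        rw [norm_smul, norm_smul, Real.norm_eq_abs, Real.norm_eq_abs, Real.norm_eq_abs,
          Real.norm_eq_abs]
        have := mul_le_mul w1 a1 (abs_nonneg _) (norm_nonneg _)
        have := mul_le_mul w2 a2 (abs_nonneg _) (norm_nonneg _)
        linarith
      have h := (convex_closedBall (0 : ℝ × ℝ) d).norm_image_sub_le_of_norm_fderiv_le
        (fun q _ => differentiable_of_smooth hv0 q) hf (mem_closedBall_self hd.le) hp
      rw [sub_zero, Real.norm_eq_abs] at h
      have hpd : ‖p‖ ≤ d := mem_closedBall_zero_iff.1 hp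
      have hdM : d ≤ τ₀ / (4 * M) := min_le_right _ _
      have : 2 * M * ‖p‖ ≤ τ₀ / 2 := by
        calc 2 * M * ‖p‖ ≤ 2 * M * (τ₀ / (4 * M)) := by gcongr; exact hpd.trans hdM
          _ = τ₀ / 2 := by field_simp; norm_num
      linarith [(abs_le.1 h).1]
    have hen := continuous_en hP.smooth hU.smooth
    have h3 : τ₀ / 2 * v ≤ ∫ p in Sq R, en V U p := by
      calc τ₀ / 2 * v = ∫ p in Sq d, τ₀ / 2 := by
            rw [setIntegral_const, smul_eq_mul, mul_comm]
        _ ≤ ∫ p in Sq d, en V U p :=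
            setIntegral_mono_on (integrableOn_Sq continuous_const d) (integrableOn_Sq hen d)
              (measurableSet_Sq d) fun p hp => (hbig p hp).trans (potential_le_en p)
        _ ≤ _ := setIntegral_mono_set (integrableOn_Sq hen _)
            (Eventually.of_forall fun p => en_nonneg hP.nonneg p)
            (Eventually.of_forall (Sq_mono hdR))
    have h4 : η' * R ≤ τ₀ / 2 * v / 2 := by
      calc η' * R ≤ τ₀ / 2 * v / (2 * K) * K :=
            mul_le_mul (min_le_right _ _) hn (hr₀.le.trans hR) (by positivity)
        _ = _ := by field_simp
    have h5 : 0 < τ₀ / 2 * v := by positivity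
    linarith
  | succ n ih =>
    intro U hU h1 h2 hE
    by_cases h : R ≤ 4 ^ n * K
    · exact ih R hR h U hU h1 h2 hE
    · have hKR : K ≤ R := by
        refine le_trans ?_ (not_le.1 h).le
        exact le_mul_of_one_le_left (by linarith) (one_le_pow₀ (by norm_num))
      have hηR : η' * R ≤ η * R := by
        gcongr
        · linarith
        · exact min_le_left _ _
      have hd := hdecay R hKR U hU h1 h2 (hE.trans hηR)
      have hsub : Sq (R / 4) ⊆ Sq R := Sq_mono (by linarith)
      refine ih (R / 4) (by linarith) (by rw [pow_succ] at hn; linarith) U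
        (hU.mono (by linarith)) (fun p hp => h1 p (hsub hp)) (fun p hp => h2 p (hsub hp)) ?_
      linarith

end ClearingOut

end AllenCahn

namespace AllenCahn

/-- A smooth convex approximation of the positive part. -/
lemma exists_smooth_posPart : ∃ g g' : ℝ → ℝ, ContDiff ℝ (⊤ : ℕ∞) g ∧ ContDiff ℝ (⊤ : ℕ∞) g' ∧
    (∀ s, HasDerivAt g (g' s) s) ∧ (∀ s, 0 ≤ g' s) ∧ (∀ s, 0 ≤ deriv g' s) ∧
    (∀ s ≤ 0, g' s = 0) ∧ (∀ s, 0 ≤ g s) ∧ (∀ s, g s ≤ max s 0) ∧ ∀ s, s - 1 ≤ g s := by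
  set f := Real.smoothTransition
  have hf : Continuous f := Real.smoothTransition.continuous
  have hii (a b : ℝ) : IntervalIntegrable f volume a b := hf.intervalIntegrable a b
  set g : ℝ → ℝ := fun s => ∫ t in (0 : ℝ)..s, f t
  have hg : ∀ s, HasDerivAt g (f s) s := fun s =>
    intervalIntegral.integral_hasDerivAt_right (hii _ _) (hf.stronglyMeasurableAtFilter _ _)
      hf.continuousAt
  have hneg : ∀ s ≤ 0, g s = 0 := fun s hs => by
    have : g s = ∫ t in (0 : ℝ)..s, (0 : ℝ) := by
      refine intervalIntegral.integral_congr fun t ht => ?_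
      rw [Set.uIcc_of_ge hs] at ht
      exact Real.smoothTransition.zero_of_nonpos ht.2
    simpa using this
  have hpos : ∀ s, 0 ≤ g s := fun s => by
    rcases le_total s 0 with h | h
    · exact (hneg s h).ge
    · exact intervalIntegral.integral_nonneg h fun t _ => Real.smoothTransition.nonneg t
  refine ⟨g, f, ?_, Real.smoothTransition.contDiff, hg, Real.smoothTransition.nonneg,
    fun s => Real.smoothTransition.monotone.deriv_nonneg,
    fun s => Real.smoothTransition.zero_of_nonpos, hpos, fun s => ?_, fun s => ?_⟩
  · refine contDiff_infty_iff_deriv.2 ⟨fun s => (hg s).differentiableAt, ?_⟩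
    rw [show deriv g = f from funext fun s => (hg s).deriv]
    exact Real.smoothTransition.contDiff
  · rcases le_total s 0 with h | h
    · rw [hneg s h]; exact le_max_right _ _
    · refine le_trans ?_ (le_max_left _ _)
      have := intervalIntegral.integral_mono_on h (hii 0 s) intervalIntegrable_const
        fun t _ => Real.smoothTransition.le_one t
      simpa using this
  · rcases le_total s 1 with h | h
    · exact (sub_nonpos.2 h).trans (hpos s)
    · have h1 : g 1 + ∫ t in (1 : ℝ)..s, f t = g s :=
        intervalIntegral.integral_add_adjacent_intervals (hii _ _) (hii _ _)
      have h2 : ∫ t in (1 : ℝ)..s, f t = ∫ t in (1 : ℝ)..s, (1 : ℝ) := by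
        refine intervalIntegral.integral_congr fun t ht => ?_
        rw [Set.uIcc_of_le h] at ht
        exact Real.smoothTransition.one_of_one_le ht.1
      rw [h2] at h1
      simp only [intervalIntegral.integral_const, smul_eq_mul, mul_one] at h1
      linarith [hpos 1]

section SupBound

variable {k : ℕ} {V : Evec k → ℝ}

/-- Interior sup bound from the subharmonicity of the modulus away from a ball. -/
lemma exists_sq_norm_le (hV : IsMultiWell V) : ∃ A > (0 : ℝ), ∃ C > (0 : ℝ), ∀ R ≥ (1 : ℝ),
    ∀ U : ℝ × ℝ → Evec k, ContDiff ℝ (⊤ : ℕ∞) U → (∀ p ∈ Sq R, lapl U p = gradient V (U p)) →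
    ∀ z ∈ Sq (R / 2), ‖U z‖ ^ 2 ≤ A + C * ((∫ p in Sq R, en V U p) / R) := by
  obtain ⟨A, hA, B, hB, hAB, hAg⟩ := exists_growth hV
  obtain ⟨C, hC, hmv⟩ := mean_value_ineq
  obtain ⟨g, g', hgs, hg's, hg, hg'0, hg''0, hg'neg, hg0, hgle, hgge⟩ := exists_smooth_posPart
  refine ⟨A + 1, by positivity, 4 * C * B, by positivity, fun R hR U hU heq z hz => ?_⟩
  have hR0 : 0 < R := by linarith
  have hUd := differentiable_of_smooth hU
  set f : ℝ × ℝ → ℝ := fun p => ⟪U p, U p⟫ - A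
  have hUU : ContDiff ℝ (⊤ : ℕ∞) fun p => ⟪U p, U p⟫ := hU.inner ℝ hU
  have hf : ContDiff ℝ (⊤ : ℕ∞) f := hUU.sub contDiff_const
  have hfn (p : ℝ × ℝ) : f p = ‖U p‖ ^ 2 - A := by simp only [f, real_inner_self_eq_norm_sq]
  have hdf (v : ℝ × ℝ) : dd v f = fun p => ⟪U p, dd v U p⟫ + ⟪dd v U p, U p⟫ := by
    funext p
    simp only [f]
    rw [dd_sub (differentiable_of_smooth hUU) (differentiable_const _), dd_inner hUd hUd]
    simp [dd]
  have hddf (v p : ℝ × ℝ) : 2 * ⟪U p, dd v (dd v U) p⟫ ≤ dd v (dd v f) p := by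
    have hdU := contDiff_dd hU v
    have hdUd := differentiable_of_smooth hdU
    rw [hdf, dd_add (differentiable_of_smooth (hU.inner ℝ hdU))
      (differentiable_of_smooth (hdU.inner ℝ hU)), dd_inner hUd hdUd, dd_inner hdUd hUd,
      real_inner_comm (U p), real_inner_self_eq_norm_sq]
    linarith [sq_nonneg ‖dd v U p‖]
  set W : ℝ × ℝ → ℝ := fun p => g (f p)
  have hW : ContDiff ℝ (⊤ : ℕ∞) W := hgs.comp hf
  have hlW : ∀ p ∈ Sq R, 0 ≤ lapl W p := by
    intro p hp
    rw [lapl_comp_real hf (fun p => hg (f p))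
      (fun p => (hg's.differentiable (by simp) (f p)).hasDerivAt)
      (differentiable_of_smooth (hg's.comp hf))]
    refine add_nonneg ?_ (mul_nonneg (hg''0 _) (by positivity))
    rcases le_or_gt (f p) 0 with h | h
    · rw [hg'neg _ h, zero_mul]
    · refine mul_nonneg (hg'0 _) ?_
      have h1 := hddf e₁ p
      have h2 := hddf e₂ p
      have h3 : 0 ≤ ⟪U p, lapl U p⟫ := by
        rw [heq p hp]
        exact hAg _ (by rw [hfn] at h; linarith)
      simp only [lapl, inner_add_right] at h3 ⊢
      linarith
  have hsub : closedBall z (R / 2) ⊆ Sq R := by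
    refine closedBall_subset_closedBall' ?_
    have : dist z 0 ≤ R / 2 := hz
    linarith
  have hen := continuous_en hV.smooth hU
  have h1 := hmv W hW z (R / 2) (by positivity) (fun p _ => hg0 _) fun p hp => hlW p (hsub hp)
  have h2 : ∫ p in closedBall z (R / 2), W p ≤ B * ∫ p in Sq R, en V U p := by
    calc ∫ p in closedBall z (R / 2), W p ≤ ∫ p in Sq R, W p :=
          setIntegral_mono_set (integrableOn_Sq hW.continuous _)
            (Eventually.of_forall fun p => hg0 _) (Eventually.of_forall hsub)
      _ ≤ ∫ p in Sq R, B * en V U p := by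
          refine setIntegral_mono_on (integrableOn_Sq hW.continuous _)
            (integrableOn_Sq (hen.const_mul B) _) (measurableSet_Sq R) fun p _ => ?_
          refine (hgle _).trans (max_le ?_ (mul_nonneg hB.le (en_nonneg hV.nonneg p)))
          rw [hfn]
          exact (hAB _).trans (by gcongr; exact potential_le_en p)
      _ = _ := integral_const_mul _ _
  have hE0 : 0 ≤ ∫ p in Sq R, en V U p := integral_nonneg fun p => en_nonneg hV.nonneg p
  have h3 := hgge (f z)
  rw [hfn] at h3
  have h4 : C / (R / 2) ^ 2 * ∫ p in closedBall z (R / 2), W p ≤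
      4 * C * B * ((∫ p in Sq R, en V U p) / R) := by
    calc _ ≤ C / (R / 2) ^ 2 * (B * ∫ p in Sq R, en V U p) := by gcongr
      _ = 4 * C * B * ((∫ p in Sq R, en V U p) / (R * R)) := by field_simp; ring
      _ ≤ _ := by
          gcongr
          exact le_mul_of_one_le_right hR0.le hR
  have h5 : W z = g (‖U z‖ ^ 2 - A) := by simp only [W, hfn]
  rw [h5] at h1
  linarith

/-- The sup bound at scale `ε = 1` on a square. -/
lemma exists_sq_norm_center_le (hV : IsMultiWell V) : ∃ C > (0 : ℝ), ∀ R ≥ (1 : ℝ),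
    ∀ U : ℝ × ℝ → Evec k, ContDiff ℝ (⊤ : ℕ∞) U → (∀ p ∈ Sq R, lapl U p = gradient V (U p)) →
    ‖U 0‖ ^ 2 ≤ C * ((∫ p in Sq R, en V U p) / R) +
      2 * sSup ((fun σ : Evec k => ‖σ‖ ^ 2) '' {y : Evec k | V y = 0}) := by
  obtain ⟨A, hA, C, hC, hsup⟩ := exists_sq_norm_le hV
  obtain ⟨l, hl, τ₀, hτ₀, hwell⟩ := exists_well_constants hV
  set ρ := √(A + C)
  obtain ⟨Λ, hΛ, hΛV⟩ := exists_hessian_bound hV.smooth ρ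
  obtain ⟨L, hL, hLV⟩ := exists_gradient_sq_le hV.smooth hV.nonneg ρ
  obtain ⟨G, hG, hGV⟩ := exists_gradient_bound hV.smooth ρ
  have hP : PotentialBounds V ρ l Λ L τ₀ :=
    ⟨hV.smooth, hV.nonneg, hl, hΛ, hL, hτ₀, hΛV, hLV, fun y hy => (hwell y hy).1,
      fun y hy => (hwell y hy).2.1⟩
  set L₀ := 2 * ρ / (1 / 4) + (G + 1) * (1 / 4) / 2
  obtain ⟨η, hη, hclear⟩ := exists_clearing_out hP hG hGV (L₀ := L₀) (by positivity)
    (r₀ := 1 / 4) (by norm_num) (by norm_num)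
  have hS := sSup_pos hV
  set S := sSup ((fun σ : Evec k => ‖σ‖ ^ 2) '' {y : Evec k | V y = 0})
  set η₁ := min 1 (η / 4)
  have hη₁ : 0 < η₁ := by positivity
  refine ⟨A / η₁ + C, by positivity, fun R hR U hU heq => ?_⟩
  have hR0 : 0 < R := by linarith
  have hen := continuous_en hV.smooth hU
  have hE0 : 0 ≤ ∫ p in Sq R, en V U p := integral_nonneg fun p => en_nonneg hV.nonneg p
  set X := (∫ p in Sq R, en V U p) / R
  have hX0 : 0 ≤ X := by positivity
  have hsup := hsup R hR U hU heq
  rcases le_or_gt X η₁ with hX | hX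
  · have hb : ∀ p ∈ Sq (R / 2), ‖U p‖ ≤ ρ := fun p hp => by
      refine Real.le_sqrt_of_sq_le ((hsup p hp).trans ?_)
      have : C * X ≤ C * 1 := by gcongr; exact hX.trans (min_le_left _ _)
      linarith
    have hmem {z p : ℝ × ℝ} (hz : z ∈ Sq (R / 4)) (hp : p ∈ Sq (1 / 4)) : z + p ∈ Sq (R / 2) := by
      rw [Sq, mem_closedBall_zero_iff] at *
      exact (norm_add_le _ _).trans (by linarith)
    have hl {z p : ℝ × ℝ} (hz : z ∈ Sq (R / 4)) (hp : p ∈ Sq (1 / 4)) :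
        ‖lapl U (z + p)‖ ≤ G := by
      rw [heq _ (Sq_mono (by linarith) (hmem hz hp))]
      exact hGV _ (hb _ (hmem hz hp))
    have h1 : ∀ z ∈ Sq (R / 4), ‖dd e₁ U z‖ ≤ L₀ := fun z hz =>
      norm_dd_fst_le hU (by norm_num) z (fun p hp => hb _ (hmem hz hp)) fun p hp => hl hz hp
    have h2 : ∀ z ∈ Sq (R / 4), ‖dd e₂ U z‖ ≤ L₀ := fun z hz =>
      norm_dd_snd_le hU (by norm_num) z (fun p hp => hb _ (hmem hz hp)) fun p hp => hl hz hp
    have hBS : BoundedSolution V U (R / 4) ρ :=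
      ⟨hU, fun p hp => heq p (Sq_mono (by linarith) hp),
        fun p hp => hb p (Sq_mono (by linarith) hp)⟩
    have hE : ∫ p in Sq (R / 4), en V U p ≤ η * (R / 4) := by
      calc ∫ p in Sq (R / 4), en V U p ≤ ∫ p in Sq R, en V U p :=
            setIntegral_mono_set (integrableOn_Sq hen _)
              (Eventually.of_forall fun p => en_nonneg hV.nonneg p)
              (Eventually.of_forall (Sq_mono (by linarith)))
        _ = X * R := by simp only [X]; field_simp
        _ ≤ η / 4 * R := by gcongr; exact hX.trans (min_le_right _ _)
        _ = _ := by ring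
    have hV0 := hclear (R / 4) (by linarith) U hBS h1 h2 hE
    have := (hwell _ hV0.le).2.2
    have : 0 ≤ (A / η₁ + C) * X := by positivity
    linarith
  · have h0 := hsup 0 (mem_closedBall_self (by positivity))
    have : A ≤ A / η₁ * X := by
      rw [div_mul_eq_mul_div, le_div_iff₀ hη₁]
      gcongr
    linarith

end SupBound

end AllenCahn

namespace AllenCahn

section Reduction

variable {k : ℕ}

/-- A map smooth on a ball extends, up to shrinking the ball, to a smooth map of the plane. -/
lemma exists_smooth_extension {u : E2 → Evec k} {x : E2} {r : ℝ} (hr : 0 < r)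
    (hu : ContDiffOn ℝ (⊤ : ℕ∞) u (ball x r)) :
    ∃ w : E2 → Evec k, ContDiff ℝ (⊤ : ℕ∞) w ∧ ∀ y ∈ ball x (3 / 4 * r), w y = u y := by
  set ζ : ContDiffBump x := ⟨3 / 4 * r, 7 / 8 * r, by positivity, by linarith⟩
  refine ⟨fun y => ζ y • u y, contDiff_iff_contDiffAt.2 fun y => ?_, fun y hy => ?_⟩
  · by_cases hy : y ∈ ball x r
    · exact ζ.contDiffAt.smul (hu.contDiffAt (isOpen_ball.mem_nhds hy))
    · have h0 : (fun y => ζ y • u y) =ᶠ[𝓝 y] fun _ => 0 := by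
        have hy' : y ∈ (closedBall x (7 / 8 * r))ᶜ := fun h =>
          hy ((closedBall_subset_ball (by linarith)) h)
        filter_upwards [isClosed_closedBall.isOpen_compl.mem_nhds hy'] with q hq
        have hq' : 7 / 8 * r ≤ dist q x := by
          rw [Set.mem_compl_iff, mem_closedBall, not_le] at hq
          exact hq.le
        rw [ζ.zero_of_le_dist hq', zero_smul]
      exact contDiffAt_const.congr_of_eventuallyEq h0
  · simp only
    rw [ζ.one_of_mem_closedBall (ball_subset_closedBall hy), one_smul]

/-- The identification of `ℝ × ℝ` with the euclidean plane. -/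
def planeMap : ℝ × ℝ →L[ℝ] E2 :=
  (ContinuousLinearMap.fst ℝ ℝ ℝ).smulRight (b2 0) + (ContinuousLinearMap.snd ℝ ℝ ℝ).smulRight (b2 1)

lemma planeMap_apply (p : ℝ × ℝ) : planeMap p = p.1 • b2 0 + p.2 • b2 1 := rfl

lemma planeMap_e₁ : planeMap e₁ = b2 0 := by simp [planeMap_apply]

lemma planeMap_e₂ : planeMap e₂ = b2 1 := by simp [planeMap_apply]

lemma planeMap_coord (y : E2) : planeMap (y 0, y 1) = y := by
  ext i
  fin_cases i <;> simp [planeMap_apply, b2]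

lemma norm_planeMap_sq (p : ℝ × ℝ) : ‖planeMap p‖ ^ 2 = p.1 ^ 2 + p.2 ^ 2 := by
  rw [EuclideanSpace.norm_sq_eq, Fin.sum_univ_two]
  simp [planeMap_apply, b2]

lemma dd_comp_planeMap {w : E2 → Evec k} (hw : Differentiable ℝ w) (x : E2) (ε : ℝ) (v : ℝ × ℝ) :
    dd v (fun p => w (x + ε • planeMap p)) =
      fun p => ε • fderiv ℝ w (x + ε • planeMap p) (planeMap v) := by
  funext p
  have h : HasFDerivAt (fun p => x + ε • planeMap p) (ε • planeMap) p :=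
    (planeMap.hasFDerivAt.const_smul ε).const_add x
  have h2 := ((hw _).hasFDerivAt.comp p h).fderiv
  simp only [dd]
  change fderiv ℝ (w ∘ fun p => x + ε • planeMap p) p v = _
  rw [h2]
  simp

lemma measurePreserving_coord : MeasurePreserving fun y : E2 => (y 0, y 1) :=
  (volume_preserving_finTwoArrow ℝ).comp (PiLp.volume_preserving_ofLp (Fin 2))

lemma measurableEmbedding_coord : MeasurableEmbedding fun y : E2 => (y 0, y 1) :=
  ((MeasurableEquiv.finTwoArrow (α := ℝ)).measurableEmbedding).comp
    (MeasurableEquiv.toLp 2 (Fin 2 → ℝ)).symm.measurableEmbedding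

lemma integrable_comp_planeMap {g : E2 → ℝ} (hg : Integrable g) (x : E2) {ε : ℝ} (hε : 0 < ε) :
    Integrable fun p => g (x + ε • planeMap p) := by
  rw [← measurePreserving_coord.integrable_comp_emb measurableEmbedding_coord]
  have : Integrable fun y : E2 => g (x + ε • y) := (hg.comp_add_left x).comp_smul hε.ne'
  refine this.congr (Eventually.of_forall fun y => ?_)
  simp only [Function.comp, planeMap_coord]

lemma integral_comp_planeMap (g : E2 → ℝ) (x : E2) {ε : ℝ} (hε : 0 < ε) :
    ∫ p, g (x + ε • planeMap p) = (ε ^ 2)⁻¹ * ∫ y, g y := by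
  rw [← measurePreserving_coord.integral_comp measurableEmbedding_coord]
  simp only [planeMap_coord]
  rw [Measure.integral_comp_smul volume (fun y => g (x + y)) ε, integral_add_left_eq_self g x,
    smul_eq_mul, finrank_euclideanSpace_fin, abs_of_pos (by positivity)]

end Reduction

end AllenCahn

namespace AllenCahn

section Main

variable {k : ℕ} {V : Evec k → ℝ}

lemma pder_congr {u w : E2 → Evec k} {y : E2} (h : w =ᶠ[𝓝 y] u) (i : Fin 2) :
    pder w i =ᶠ[𝓝 y] pder u i := by
  filter_upwards [h.fderiv (𝕜 := ℝ)] with z hz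
  simp only [pder, hz]

lemma lap_congr {u w : E2 → Evec k} {y : E2} (h : w =ᶠ[𝓝 y] u) : lap w y = lap u y := by
  simp only [lap, (pder_congr h _).fderiv_eq]

lemma lapl_comp_planeMap {w : E2 → Evec k} (hw : ContDiff ℝ (⊤ : ℕ∞) w) (x : E2) (ε : ℝ)
    (p : ℝ × ℝ) :
    lapl (fun p => w (x + ε • planeMap p)) p = ε ^ 2 • lap w (x + ε • planeMap p) := by
  have hp : ∀ i, Differentiable ℝ (pder w i) := fun i =>
    ((hw.fderiv_right (m := ((⊤ : ℕ∞) : WithTop ℕ∞)) (by simp)).clm_apply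
      contDiff_const).differentiable (by simp)
  have key : ∀ (v : ℝ × ℝ) (i : Fin 2), planeMap v = b2 i →
      dd v (dd v fun p => w (x + ε • planeMap p)) p =
        ε ^ 2 • fderiv ℝ (pder w i) (x + ε • planeMap p) (b2 i) := by
    intro v i hv
    rw [dd_comp_planeMap (hw.differentiable (by simp)), hv]
    have h := dd_comp_planeMap ((hp i).const_smul ε) x ε v
    refine (congrFun h p).trans ?_
    have h2 : fderiv ℝ (ε • pder w i) (x + ε • planeMap p) =
        ε • fderiv ℝ (pder w i) (x + ε • planeMap p) :=
      fderiv_const_smul (hp i _) ε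
    change ε • fderiv ℝ (ε • pder w i) (x + ε • planeMap p) (planeMap v) = _
    rw [h2, hv, _root_.smul_apply, smul_smul, pow_two]
  simp only [lapl]
  rw [key _ 0 planeMap_e₁, key _ 1 planeMap_e₂, lap, Fin.sum_univ_two, smul_add]

lemma en_comp_planeMap {w : E2 → Evec k} (hw : Differentiable ℝ w) (x : E2) {ε : ℝ} (hε : 0 < ε)
    (p : ℝ × ℝ) :
    en V (fun p => w (x + ε • planeMap p)) p = ε * eDens V ε w (x + ε • planeMap p) := by
  simp only [en, dd_comp_planeMap hw, planeMap_e₁, planeMap_e₂, norm_smul, mul_pow, eDens, gradSq,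
    Fin.sum_univ_two, pder, Real.norm_eq_abs, sq_abs]
  field_simp

lemma eDens_congr {u w : E2 → Evec k} {y : E2} (h : w =ᶠ[𝓝 y] u) (ε : ℝ) :
    eDens V ε w y = eDens V ε u y := by
  simp only [eDens, gradSq, (pder_congr h _).eq_of_nhds, h.eq_of_nhds]

lemma eDens_nonneg (h0 : ∀ y, 0 ≤ V y) {ε : ℝ} (hε : 0 < ε) (u : E2 → Evec k) (y : E2) :
    0 ≤ eDens V ε u y := by
  have := h0 (u y)
  unfold eDens gradSq
  positivity

end Main

end AllenCahn

/-- L∞ bound via the maximum principle. There is `C > 0`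
depending only on `V` such that for every solution `u_ε` on a bounded open
`Ω ⊂ ℝ²` with `0 < ε ≤ 1`, and every `x ∈ Ω` with `dist(x,∂Ω) ≥ 2ε`,
`|u_ε(x)|² ≤ C·E_ε(u_ε,Ω)/dist(x,∂Ω) + 2·max{|σ|² : σ ∈ Σ}`. -/
theorem statement_15 (k : ℕ) (hk : 1 ≤ k) (V : Evec k → ℝ) (hV : IsMultiWell V) :
    ∃ C > (0 : ℝ),
      ∀ (Ω : Set E2), IsOpen Ω → IsBounded Ω →
      ∀ ε : ℝ, 0 < ε → ε ≤ 1 →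
      ∀ u : E2 → Evec k, IsSolution V ε Ω u →
        IntegrableOn (eDens V ε u) Ω →
        ∀ x ∈ Ω, 2 * ε ≤ infDist x Ωᶜ →
          ‖u x‖ ^ 2 ≤ C * energy V ε u Ω / infDist x Ωᶜ +
            2 * sSup ((fun σ : Evec k => ‖σ‖ ^ 2) '' {y : Evec k | V y = 0}) := by
  obtain ⟨C, hC, hmain⟩ := AllenCahn.exists_sq_norm_center_le hV
  refine ⟨2 * C, by positivity, fun Ω hΩ _ ε hε _ u hu h_int x _ hx => ?_⟩
  set r := infDist x Ωᶜ with hr_def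
  have hr : 0 < r := by linarith
  have hball : ball x r ⊆ Ω := fun y hy => by
    by_contra hyΩ
    have := infDist_le_dist_of_mem (x := x) (s := Ωᶜ) hyΩ
    rw [mem_ball, dist_comm] at hy
    linarith
  obtain ⟨w, hw, hwu⟩ := AllenCahn.exists_smooth_extension hr (hu.1.mono hball)
  have hwd : Differentiable ℝ w := hw.differentiable (by simp)
  set R := r / (2 * ε) with hR_def
  have hR : 1 ≤ R := by rw [hR_def, le_div_iff₀ (by positivity)]; linarith
  have hmem : ∀ p ∈ AllenCahn.Sq R, x + ε • AllenCahn.planeMap p ∈ ball x (3 / 4 * r) := by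
    intro p hp
    rw [AllenCahn.mem_Sq] at hp
    have h1 : p.1 ^ 2 ≤ R ^ 2 := sq_le_sq' (abs_le.1 hp.1).1 (abs_le.1 hp.1).2
    have h2 : p.2 ^ 2 ≤ R ^ 2 := sq_le_sq' (abs_le.1 hp.2).1 (abs_le.1 hp.2).2
    have h3 : ε * R = r / 2 := by rw [hR_def]; field_simp
    rw [mem_ball, dist_eq_norm, add_sub_cancel_left, norm_smul, Real.norm_of_nonneg hε.le]
    refine lt_of_pow_lt_pow_left₀ 2 (by positivity) ?_
    rw [mul_pow, AllenCahn.norm_planeMap_sq]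
    calc ε ^ 2 * (p.1 ^ 2 + p.2 ^ 2) ≤ ε ^ 2 * (R ^ 2 + R ^ 2) := by gcongr
      _ = 2 * (ε * R) ^ 2 := by ring
      _ < (3 / 4 * r) ^ 2 := by rw [h3]; nlinarith [sq_pos_of_pos hr]
  have hsub : ball x (3 / 4 * r) ⊆ Ω := (ball_subset_ball (by linarith)).trans hball
  have hev : ∀ p ∈ AllenCahn.Sq R, w =ᶠ[𝓝 (x + ε • AllenCahn.planeMap p)] u := fun p hp => by
    filter_upwards [isOpen_ball.mem_nhds (hmem p hp)] using hwu
  set U : ℝ × ℝ → Evec k := fun p => w (x + ε • AllenCahn.planeMap p) with hU_def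
  have hU : ContDiff ℝ (⊤ : ℕ∞) U :=
    hw.comp (contDiff_const.add (AllenCahn.planeMap.contDiff.const_smul ε))
  have hsol : ∀ p ∈ AllenCahn.Sq R, AllenCahn.lapl U p = gradient V (U p) := by
    intro p hp
    rw [hU_def, AllenCahn.lapl_comp_planeMap hw, AllenCahn.lap_congr (hev p hp),
      hu.2 _ (hsub (hmem p hp)), smul_smul, mul_inv_cancel₀ (by positivity), one_smul]
    simp only [hwu _ (hmem p hp)]
  have hI : Integrable (Ω.indicator (eDens V ε u)) :=
    (integrable_indicator_iff hΩ.measurableSet).2 h_int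
  have hI' : Integrable fun p => ε * Ω.indicator (eDens V ε u) (x + ε • AllenCahn.planeMap p) :=
    (AllenCahn.integrable_comp_planeMap hI x hε).const_mul ε
  have hen : ∫ p in AllenCahn.Sq R, AllenCahn.en V U p ≤ ε⁻¹ * energy V ε u Ω := by
    calc ∫ p in AllenCahn.Sq R, AllenCahn.en V U p
        = ∫ p in AllenCahn.Sq R,
            ε * Ω.indicator (eDens V ε u) (x + ε • AllenCahn.planeMap p) := by
          refine setIntegral_congr_fun (AllenCahn.measurableSet_Sq R) fun p hp => ?_
          simp only [hU_def]
          rw [AllenCahn.en_comp_planeMap hwd x hε, AllenCahn.eDens_congr (hev p hp),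
            Set.indicator_of_mem (hsub (hmem p hp))]
      _ ≤ ∫ p, ε * Ω.indicator (eDens V ε u) (x + ε • AllenCahn.planeMap p) :=
          setIntegral_le_integral hI' <| Eventually.of_forall fun p =>
            mul_nonneg hε.le <| Set.indicator_nonneg
              (fun y _ => AllenCahn.eDens_nonneg hV.nonneg hε u y) _
      _ = ε⁻¹ * energy V ε u Ω := by
          rw [integral_const_mul, AllenCahn.integral_comp_planeMap _ x hε,
            integral_indicator hΩ.measurableSet, energy]
          field_simp
  have hU0 : U 0 = u x := by
    simp only [hU_def, map_zero, smul_zero, add_zero]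
    exact hwu x (mem_ball_self (by positivity))
  have hfin := hmain R hR U hU hsol
  rw [hU0] at hfin
  refine hfin.trans (add_le_add_left ?_ _)
  calc C * ((∫ p in AllenCahn.Sq R, AllenCahn.en V U p) / R)
      ≤ C * (ε⁻¹ * energy V ε u Ω / R) := by gcongr
    _ = 2 * C * energy V ε u Ω / r := by rw [hR_def]; field_simp
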